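/- Let h(u,v) = \sum_{i=0}^{12} \binom{12}{i} \alpha_i u^i v^{12-i} with (\alpha_0, \dots, \alpha_{12}) = (55, 29, -7, -3, -9, -15, -81/7, 9, -9, -27, -135, -459, 567). Define g = (1/132^2)(h_{uu} h_{vv} - h_{uv}^2) and f = (1/240)(h_u g_v - h_v g_u), where subscripts denote partial derivatives with respect to u and v; then f is a binary form of degree 30 with integer coefficients. There are no integers u, v, y with (u, v) \neq (0, 0) and y^2 = -f(u, v). -/

import Mathlib

section FrozenDefs
open MvPolynomial

/-- The coefficient vector `(α₀, …, α₁₂)`. -/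
noncomputable def alphaC40 : Fin 13 → ℚ := ![55, 29, -7, -3, -9, -15, -81/7, 9, -9, -27, -135, -459, 567]

/-- The binary form `h(u,v) = ∑ i, (12 choose i) αᵢ uⁱ v^(12-i)`,
as a polynomial in the two variables `X 0 = u` and `X 1 = v`. -/
noncomputable def hC40 : MvPolynomial (Fin 2) ℚ :=
  ∑ i : Fin 13, C ((Nat.choose 12 i : ℚ) * alphaC40 i) * X 0 ^ (i : ℕ) * X 1 ^ (12 - (i : ℕ))

/-- `g = (1/132²)·(h_uu h_vv - h_uv²)`. -/
noncomputable def gC40 : MvPolynomial (Fin 2) ℚ :=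
  C ((1 : ℚ) / 132 ^ 2) *
    (pderiv 0 (pderiv 0 hC40) * pderiv 1 (pderiv 1 hC40) -
      pderiv 1 (pderiv 0 hC40) * pderiv 1 (pderiv 0 hC40))

/-- `f = (1/240)·(h_u g_v - h_v g_u)`. -/
noncomputable def fC40 : MvPolynomial (Fin 2) ℚ :=
  C ((1 : ℚ) / 240) *
    (pderiv 0 hC40 * pderiv 1 gC40 - pderiv 1 hC40 * pderiv 0 gC40)

end FrozenDefs

/-- The ring of integers of the quintic field, in coordinates with respect to
`1, θ, θ², (θ²+θ³)/2, (2θ+θ³+θ⁴)/4`, where `θ⁵ = 5θ⁴+20θ³+20θ²+20θ+20`. -/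
@[ext]
structure L5 where
  a : ℤ
  b : ℤ
  c : ℤ
  d : ℤ
  e : ℤ
  deriving DecidableEq

namespace L5

instance : Zero L5 := ⟨⟨0, 0, 0, 0, 0⟩⟩
instance : One L5 := ⟨⟨1, 0, 0, 0, 0⟩⟩
instance : Add L5 := ⟨fun x y => ⟨x.a + y.a, x.b + y.b, x.c + y.c, x.d + y.d, x.e + y.e⟩⟩
instance : Neg L5 := ⟨fun x => ⟨-x.a, -x.b, -x.c, -x.d, -x.e⟩⟩
instance : Sub L5 := ⟨fun x y => ⟨x.a - y.a, x.b - y.b, x.c - y.c, x.d - y.d, x.e - y.e⟩⟩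
instance : Mul L5 := ⟨fun x y =>
  ⟨x.a*y.a + 5*(x.b*y.e+x.e*y.b) + 10*(x.c*y.d+x.d*y.c) + 30*(x.c*y.e+x.e*y.c) + 35*x.d*y.d + 140*(x.d*y.e+x.e*y.d) + 555*x.e*y.e,
   (x.a*y.b+x.b*y.a) - 1*(x.b*y.d+x.d*y.b) + 2*(x.b*y.e+x.e*y.b) - 2*x.c*y.c + 4*(x.c*y.d+x.d*y.c) + 10*(x.c*y.e+x.e*y.c) + 12*x.d*y.d + 47*(x.d*y.e+x.e*y.d) + 187*x.e*y.e,
   (x.a*y.c+x.c*y.a) + x.b*y.b - 1*(x.b*y.c+x.c*y.b) + 2*(x.b*y.e+x.e*y.b) + x.c*y.c + 3*(x.c*y.d+x.d*y.c) + 12*(x.c*y.e+x.e*y.c) + 14*x.d*y.d + 55*(x.d*y.e+x.e*y.d) + 218*x.e*y.e,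
   (x.a*y.d+x.d*y.a) + 2*(x.b*y.c+x.c*y.b) + 7*(x.b*y.e+x.e*y.b) - 2*x.c*y.c + 14*(x.c*y.d+x.d*y.c) + 46*(x.c*y.e+x.e*y.c) + 52*x.d*y.d + 210*(x.d*y.e+x.e*y.d) + 832*x.e*y.e,
   (x.a*y.e+x.e*y.a) + 2*(x.b*y.d+x.d*y.b) + 6*(x.b*y.e+x.e*y.b) + 4*x.c*y.c + 12*(x.c*y.d+x.d*y.c) + 50*(x.c*y.e+x.e*y.c) + 56*x.d*y.d + 221*(x.d*y.e+x.e*y.d) + 876*x.e*y.e⟩⟩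
instance : NatCast L5 := ⟨fun n => ⟨n, 0, 0, 0, 0⟩⟩
instance : IntCast L5 := ⟨fun n => ⟨n, 0, 0, 0, 0⟩⟩
instance : SMul ℕ L5 := ⟨fun n x => ⟨n * x.a, n * x.b, n * x.c, n * x.d, n * x.e⟩⟩
instance : SMul ℤ L5 := ⟨fun n x => ⟨n * x.a, n * x.b, n * x.c, n * x.d, n * x.e⟩⟩

@[simp] theorem zero_a : (0 : L5).a = 0 := rfl
@[simp] theorem zero_b : (0 : L5).b = 0 := rfl
@[simp] theorem zero_c : (0 : L5).c = 0 := rfl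
@[simp] theorem zero_d : (0 : L5).d = 0 := rfl
@[simp] theorem zero_e : (0 : L5).e = 0 := rfl
@[simp] theorem one_a : (1 : L5).a = 1 := rfl
@[simp] theorem one_b : (1 : L5).b = 0 := rfl
@[simp] theorem one_c : (1 : L5).c = 0 := rfl
@[simp] theorem one_d : (1 : L5).d = 0 := rfl
@[simp] theorem one_e : (1 : L5).e = 0 := rfl
@[simp] theorem add_a (x y : L5) : (x + y).a = x.a + y.a := rfl
@[simp] theorem add_b (x y : L5) : (x + y).b = x.b + y.b := rfl
@[simp] theorem add_c (x y : L5) : (x + y).c = x.c + y.c := rfl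
@[simp] theorem add_d (x y : L5) : (x + y).d = x.d + y.d := rfl
@[simp] theorem add_e (x y : L5) : (x + y).e = x.e + y.e := rfl
@[simp] theorem sub_a (x y : L5) : (x - y).a = x.a - y.a := rfl
@[simp] theorem sub_b (x y : L5) : (x - y).b = x.b - y.b := rfl
@[simp] theorem sub_c (x y : L5) : (x - y).c = x.c - y.c := rfl
@[simp] theorem sub_d (x y : L5) : (x - y).d = x.d - y.d := rfl
@[simp] theorem sub_e (x y : L5) : (x - y).e = x.e - y.e := rfl
@[simp] theorem neg_a (x : L5) : (-x).a = -x.a := rfl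
@[simp] theorem neg_b (x : L5) : (-x).b = -x.b := rfl
@[simp] theorem neg_c (x : L5) : (-x).c = -x.c := rfl
@[simp] theorem neg_d (x : L5) : (-x).d = -x.d := rfl
@[simp] theorem neg_e (x : L5) : (-x).e = -x.e := rfl
theorem mul_a (x y : L5) : (x * y).a =
    x.a*y.a + 5*(x.b*y.e+x.e*y.b) + 10*(x.c*y.d+x.d*y.c) + 30*(x.c*y.e+x.e*y.c) + 35*x.d*y.d + 140*(x.d*y.e+x.e*y.d) + 555*x.e*y.e := rfl
theorem mul_b (x y : L5) : (x * y).b =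
    (x.a*y.b+x.b*y.a) - 1*(x.b*y.d+x.d*y.b) + 2*(x.b*y.e+x.e*y.b) - 2*x.c*y.c + 4*(x.c*y.d+x.d*y.c) + 10*(x.c*y.e+x.e*y.c) + 12*x.d*y.d + 47*(x.d*y.e+x.e*y.d) + 187*x.e*y.e := rfl
theorem mul_c (x y : L5) : (x * y).c =
    (x.a*y.c+x.c*y.a) + x.b*y.b - 1*(x.b*y.c+x.c*y.b) + 2*(x.b*y.e+x.e*y.b) + x.c*y.c + 3*(x.c*y.d+x.d*y.c) + 12*(x.c*y.e+x.e*y.c) + 14*x.d*y.d + 55*(x.d*y.e+x.e*y.d) + 218*x.e*y.e := rfl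
theorem mul_d (x y : L5) : (x * y).d =
    (x.a*y.d+x.d*y.a) + 2*(x.b*y.c+x.c*y.b) + 7*(x.b*y.e+x.e*y.b) - 2*x.c*y.c + 14*(x.c*y.d+x.d*y.c) + 46*(x.c*y.e+x.e*y.c) + 52*x.d*y.d + 210*(x.d*y.e+x.e*y.d) + 832*x.e*y.e := rfl
theorem mul_e (x y : L5) : (x * y).e =
    (x.a*y.e+x.e*y.a) + 2*(x.b*y.d+x.d*y.b) + 6*(x.b*y.e+x.e*y.b) + 4*x.c*y.c + 12*(x.c*y.d+x.d*y.c) + 50*(x.c*y.e+x.e*y.c) + 56*x.d*y.d + 221*(x.d*y.e+x.e*y.d) + 876*x.e*y.e := rfl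
@[simp] theorem ncast_a (n : ℕ) : (n : L5).a = n := rfl
@[simp] theorem ncast_b (n : ℕ) : (n : L5).b = 0 := rfl
@[simp] theorem ncast_c (n : ℕ) : (n : L5).c = 0 := rfl
@[simp] theorem ncast_d (n : ℕ) : (n : L5).d = 0 := rfl
@[simp] theorem ncast_e (n : ℕ) : (n : L5).e = 0 := rfl
@[simp] theorem zcast_a (n : ℤ) : (n : L5).a = n := rfl
@[simp] theorem zcast_b (n : ℤ) : (n : L5).b = 0 := rfl
@[simp] theorem zcast_c (n : ℤ) : (n : L5).c = 0 := rfl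
@[simp] theorem zcast_d (n : ℤ) : (n : L5).d = 0 := rfl
@[simp] theorem zcast_e (n : ℤ) : (n : L5).e = 0 := rfl
@[simp] theorem nsm_a (n : ℕ) (x : L5) : (n • x).a = n * x.a := rfl
@[simp] theorem nsm_b (n : ℕ) (x : L5) : (n • x).b = n * x.b := rfl
@[simp] theorem nsm_c (n : ℕ) (x : L5) : (n • x).c = n * x.c := rfl
@[simp] theorem nsm_d (n : ℕ) (x : L5) : (n • x).d = n * x.d := rfl
@[simp] theorem nsm_e (n : ℕ) (x : L5) : (n • x).e = n * x.e := rfl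
@[simp] theorem zsm_a (n : ℤ) (x : L5) : (n • x).a = n * x.a := rfl
@[simp] theorem zsm_b (n : ℤ) (x : L5) : (n • x).b = n * x.b := rfl
@[simp] theorem zsm_c (n : ℤ) (x : L5) : (n • x).c = n * x.c := rfl
@[simp] theorem zsm_d (n : ℤ) (x : L5) : (n • x).d = n * x.d := rfl
@[simp] theorem zsm_e (n : ℤ) (x : L5) : (n • x).e = n * x.e := rfl

instance : CommRing L5 where
  add_assoc x y z := by ext <;> simp <;> ring
  zero_add x := by ext <;> simp
  add_zero x := by ext <;> simp
  add_comm x y := by ext <;> simp <;> ring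
  neg_add_cancel x := by ext <;> simp
  sub_eq_add_neg x y := by ext <;> simp <;> ring
  mul_assoc x y z := by
    ext <;> simp only [mul_a, mul_b, mul_c, mul_d, mul_e] <;> ring
  one_mul x := by ext <;> simp [mul_a, mul_b, mul_c, mul_d, mul_e]
  mul_one x := by ext <;> simp [mul_a, mul_b, mul_c, mul_d, mul_e]
  mul_comm x y := by ext <;> simp only [mul_a, mul_b, mul_c, mul_d, mul_e] <;> ring
  left_distrib x y z := by
    ext <;> simp only [mul_a, mul_b, mul_c, mul_d, mul_e, add_a, add_b, add_c, add_d, add_e] <;> ring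
  right_distrib x y z := by
    ext <;> simp only [mul_a, mul_b, mul_c, mul_d, mul_e, add_a, add_b, add_c, add_d, add_e] <;> ring
  zero_mul x := by ext <;> simp [mul_a, mul_b, mul_c, mul_d, mul_e]
  mul_zero x := by ext <;> simp [mul_a, mul_b, mul_c, mul_d, mul_e]
  natCast_zero := by ext <;> simp
  natCast_succ n := by ext <;> simp
  intCast_ofNat n := by ext <;> simp
  intCast_negSucc n := by ext <;> simp [Int.negSucc_eq]
  nsmul n x := n • x
  nsmul_zero x := by ext <;> simp
  nsmul_succ n x := by ext <;> simp <;> ring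
  zsmul n x := n • x
  zsmul_zero' x := by ext <;> simp
  zsmul_succ' n x := by ext <;> simp <;> ring
  zsmul_neg' n x := by ext <;> simp [Int.negSucc_eq] <;> ring

/-- The element `θ`. -/
def th : L5 := ⟨0, 1, 0, 0, 0⟩

end L5



open Polynomial in
/-- The defining polynomial of the quintic field, over `ℤ`. -/
noncomputable def gZ5 : ℤ[X] := X ^ 5 - 5 * X ^ 4 - 20 * X ^ 3 - 20 * X ^ 2 - 20 * X - 20

theorem gZ5_natDegree : gZ5.natDegree = 5 := by
  unfold gZ5; compute_degree!

theorem gZ5_monic : gZ5.Monic := by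
  unfold gZ5; monicity!

theorem gZ5_irreducible : Irreducible gZ5 := by
  have hp : (Ideal.span {(5 : ℤ)}).IsPrime :=
    (Ideal.span_singleton_prime (by norm_num)).2 (by norm_num)
  apply Polynomial.irreducible_of_eisenstein_criterion hp
  · rw [gZ5_monic.leadingCoeff]
    intro h
    exact hp.ne_top ((Ideal.eq_top_iff_one _).2 h)
  · intro n hn
    have hd : gZ5.degree = 5 := by
      rw [Polynomial.degree_eq_natDegree gZ5_monic.ne_zero, gZ5_natDegree]; rfl
    rw [hd] at hn
    have hn' : n < 5 := by exact_mod_cast hn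
    rw [Ideal.mem_span_singleton]
    have e : gZ5 = Polynomial.X ^ 5 - Polynomial.C 5 * Polynomial.X ^ 4
      - Polynomial.C 20 * Polynomial.X ^ 3 - Polynomial.C 20 * Polynomial.X ^ 2
      - Polynomial.C 20 * Polynomial.X - Polynomial.C 20 := by simp [gZ5]
    interval_cases n <;> simp [e, Polynomial.coeff_X_pow, Polynomial.coeff_X] <;> norm_num
  · rw [Polynomial.degree_eq_natDegree gZ5_monic.ne_zero, gZ5_natDegree]; norm_num
  · rw [Ideal.span_singleton_pow, Ideal.mem_span_singleton, Polynomial.coeff_zero_eq_eval_zero]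
    simp [gZ5]
  · exact gZ5_monic.isPrimitive

/-- The defining polynomial of the quintic field, over `ℚ`. -/
noncomputable def gQ5 : Polynomial ℚ := gZ5.map (algebraMap ℤ ℚ)

theorem gQ5_monic : gQ5.Monic := gZ5_monic.map _

theorem gQ5_natDegree : gQ5.natDegree = 5 := by
  rw [gQ5, gZ5_monic.natDegree_map, gZ5_natDegree]

instance gQ5_irreducible : Fact (Irreducible gQ5) :=
  ⟨(Polynomial.Monic.irreducible_iff_irreducible_map_fraction_map gZ5_monic).1 gZ5_irreducible⟩

/-- The quintic field. -/
abbrev K5 := AdjoinRoot gQ5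

/-- The generator of the quintic field. -/
noncomputable def t5 : K5 := AdjoinRoot.root gQ5

theorem t5_eq : t5 ^ 5 = 5 * t5 ^ 4 + 20 * t5 ^ 3 + 20 * t5 ^ 2 + 20 * t5 + 20 := by
  have h : Polynomial.aeval t5 gQ5 = 0 := AdjoinRoot.aeval_eq gQ5 ▸ AdjoinRoot.mk_self
  simp only [gQ5, gZ5, Polynomial.aeval_map_algebraMap] at h
  simp only [map_sub, map_mul, map_pow, map_ofNat, Polynomial.aeval_X] at h
  linear_combination h

noncomputable instance : FiniteDimensional ℚ K5 :=
  (AdjoinRoot.powerBasis gQ5_monic.ne_zero).finite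

noncomputable instance : CharZero K5 := algebraRat.charZero K5

noncomputable instance : NumberField K5 where

theorem finrank_K5 : Module.finrank ℚ K5 = 5 := by
  rw [(AdjoinRoot.powerBasis gQ5_monic.ne_zero).finrank, AdjoinRoot.powerBasis_dim, gQ5_natDegree]

/-- The value in `K5` of an element of `L5`, before bundling. -/
noncomputable def iotaFun (x : L5) : K5 :=
  x.a + x.b * t5 + x.c * t5 ^ 2 + x.d * ((t5 ^ 2 + t5 ^ 3) / 2)
    + x.e * ((2 * t5 + t5 ^ 3 + t5 ^ 4) / 4)

theorem iotaFun_mul (x y : L5) : iotaFun (x * y) = iotaFun x * iotaFun y := by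
  have h5 := t5_eq
  have h6 : t5 ^ 6 = 45 * t5 ^ 4 + 120 * t5 ^ 3 + 120 * t5 ^ 2 + 120 * t5 + 100 := by
    linear_combination (t5 + 5) * h5
  have h7 : t5 ^ 7 = 345 * t5 ^ 4 + 1020 * t5 ^ 3 + 1020 * t5 ^ 2 + 1000 * t5 + 900 := by
    linear_combination t5 * h6 + 45 * h5
  have h8 : t5 ^ 8 = 2745 * t5 ^ 4 + 7920 * t5 ^ 3 + 7900 * t5 ^ 2 + 7800 * t5 + 6900 := by
    linear_combination t5 * h7 + 345 * h5
  simp only [iotaFun, L5.mul_a, L5.mul_b, L5.mul_c, L5.mul_d, L5.mul_e]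
  push_cast
  linear_combination
    -(((x.b : K5) + x.e / 2) * (y.e / 4) + ((x.c : K5) + x.d / 2) * (y.d / 2 + y.e / 4)
      + ((y.b : K5) + y.e / 2) * (x.e / 4) + ((y.c : K5) + y.d / 2) * (x.d / 2 + x.e / 4)) * h5
    - (((x.c : K5) + x.d / 2) * (y.e / 4) + ((y.c : K5) + y.d / 2) * (x.e / 4)
      + ((x.d : K5) / 2 + x.e / 4) * (y.d / 2 + y.e / 4)) * h6
    - (((x.d : K5) / 2 + x.e / 4) * (y.e / 4) + ((y.d : K5) / 2 + y.e / 4) * (x.e / 4)) * h7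
    - ((x.e : K5) / 4 * (y.e / 4)) * h8

/-- The embedding of `L5` into the quintic field. -/
noncomputable def iota : L5 →+* K5 where
  toFun := iotaFun
  map_one' := by simp [iotaFun]
  map_zero' := by simp [iotaFun]
  map_mul' := iotaFun_mul
  map_add' x y := by simp [iotaFun]; ring

theorem iota_apply (x : L5) : iota x = x.a + x.b * t5 + x.c * t5 ^ 2 + x.d * ((t5 ^ 2 + t5 ^ 3) / 2)
    + x.e * ((2 * t5 + t5 ^ 3 + t5 ^ 4) / 4) := rfl

/-- A rational combination of powers of `t5` is zero only trivially. -/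
theorem t5_indep (q : Fin 5 → ℚ) (h : ∑ i, q i • t5 ^ (i : ℕ) = 0) : ∀ i, q i = 0 := by
  have hli := (AdjoinRoot.powerBasis gQ5_monic.ne_zero).basis.linearIndependent
  have hdim : (AdjoinRoot.powerBasis gQ5_monic.ne_zero).dim = 5 := by
    rw [AdjoinRoot.powerBasis_dim, gQ5_natDegree]
  have hli2 := hli.comp (finCongr hdim.symm) (finCongr hdim.symm).injective
  rw [Fintype.linearIndependent_iff] at hli2
  apply hli2 q
  rw [← h]
  apply Finset.sum_congr rfl
  intro i _
  simp [t5]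

/-- Every element of `K5` is a rational combination of powers of `t5`. -/
theorem t5_span (x : K5) : ∃ q : Fin 5 → ℚ, x = ∑ i, q i • t5 ^ (i : ℕ) := by
  have hdim : (AdjoinRoot.powerBasis gQ5_monic.ne_zero).dim = 5 := by
    rw [AdjoinRoot.powerBasis_dim, gQ5_natDegree]
  let b := (AdjoinRoot.powerBasis gQ5_monic.ne_zero).basis.reindex (finCongr hdim)
  refine ⟨b.repr x, ?_⟩
  conv_lhs => rw [← b.sum_repr x]
  apply Finset.sum_congr rfl
  intro i _
  simp [t5, b]

theorem iota_injective : Function.Injective iota := by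
  rw [injective_iff_map_eq_zero]
  intro x hx
  have h := t5_indep ![(x.a : ℚ), x.b + x.e / 2, x.c + x.d / 2, x.d / 2 + x.e / 4, x.e / 4] (by
    rw [iota_apply] at hx
    simp [Fin.sum_univ_five, Algebra.smul_def]
    linear_combination hx)
  have h0 := h 0
  have h1 := h 1
  have h2 := h 2
  have h3 := h 3
  have h4 := h 4
  simp at h0 h1 h2 h3 h4
  have e4 : (x.e : ℚ) = 0 := by exact_mod_cast h4
  have e3 : (x.d : ℚ) = 0 := by linarith
  have e2 : (x.c : ℚ) = 0 := by linarith
  have e1 : (x.b : ℚ) = 0 := by linarith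
  ext
  · exact_mod_cast h0
  · exact_mod_cast e1
  · exact_mod_cast e2
  · exact_mod_cast e3
  · exact_mod_cast e4

instance : IsDomain L5 := iota_injective.isDomain iota

/-- Every element of `K5` is a quotient of an element of `L5` by a nonzero integer. -/
theorem exists_denom (x : K5) : ∃ (n : ℤ) (y : L5), n ≠ 0 ∧ (n : K5) * x = iota y := by
  obtain ⟨q, hq⟩ := t5_span x
  obtain ⟨⟨n, hn⟩, hz⟩ := IsLocalization.exist_integer_multiples_of_finset (nonZeroDivisors ℤ)
    (Finset.univ.image q)
  have hz' : ∀ i, ∃ z : ℤ, (n : ℚ) * q i = z := by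
    intro i
    obtain ⟨z, hz⟩ := hz (q i) (by simp)
    refine ⟨z, ?_⟩
    simpa [Algebra.smul_def] using! hz.symm
  choose z hz' using hz'
  refine ⟨n, ⟨z 0, z 1 - 2 * z 4, z 2 - z 3 + z 4, 2 * z 3 - 2 * z 4, 4 * z 4⟩,
    nonZeroDivisors.ne_zero hn, ?_⟩
  have hc : ∀ i, (n : K5) * (q i : K5) = z i := by
    intro i
    have := congrArg (fun r : ℚ => (r : K5)) (hz' i)
    simpa using this
  rw [hq, iota_apply]
  simp [Fin.sum_univ_five, Algebra.smul_def]
  linear_combination hc 0 + t5 * hc 1 + t5 ^ 2 * hc 2 + t5 ^ 3 * hc 3 + t5 ^ 4 * hc 4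


instance fact_prime_five : Fact (Nat.Prime 5) := ⟨by norm_num⟩

namespace L5

/-- Coordinatewise divisibility by an integer. -/
def Dvdc (p : ℤ) (x : L5) : Prop := p ∣ x.a ∧ p ∣ x.b ∧ p ∣ x.c ∧ p ∣ x.d ∧ p ∣ x.e

instance (p : ℤ) (x : L5) : Decidable (Dvdc p x) := by unfold Dvdc; infer_instance

theorem intCast_mul_eq (p : ℤ) (x : L5) : (p : L5) * x = ⟨p * x.a, p * x.b, p * x.c, p * x.d, p * x.e⟩ := by
  ext <;> simp [mul_a, mul_b, mul_c, mul_d, mul_e]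

theorem dvd_iff_dvdc (p : ℤ) (x : L5) : (p : L5) ∣ x ↔ Dvdc p x := by
  constructor
  · rintro ⟨y, rfl⟩
    rw [intCast_mul_eq]
    exact ⟨⟨_, rfl⟩, ⟨_, rfl⟩, ⟨_, rfl⟩, ⟨_, rfl⟩, ⟨_, rfl⟩⟩
  · rintro ⟨⟨a, ha⟩, ⟨b, hb⟩, ⟨c, hc⟩, ⟨d, hd⟩, ⟨e, he⟩⟩
    refine ⟨⟨a, b, c, d, e⟩, ?_⟩
    rw [intCast_mul_eq]
    ext <;> assumption

instance : CharZero L5 := by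
  refine ⟨fun m n h => ?_⟩
  have := congrArg L5.a h
  simpa using this

/-- Certificate that `γ` generates a prime ideal with residue field `𝔽_p`, in which the basis
elements reduce to `1, v1, v2, v3, v4`. -/
def PCert (p v1 v2 v3 v4 : ℤ) (γ a : L5) : Prop :=
  γ * a = (p : L5) ∧ Dvdc p (a * ⟨-v1, 1, 0, 0, 0⟩) ∧ Dvdc p (a * ⟨-v2, 0, 1, 0, 0⟩) ∧
    Dvdc p (a * ⟨-v3, 0, 0, 1, 0⟩) ∧ Dvdc p (a * ⟨-v4, 0, 0, 0, 1⟩)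

instance (p v1 v2 v3 v4 : ℤ) (γ a : L5) : Decidable (PCert p v1 v2 v3 v4 γ a) := by
  unfold PCert; infer_instance

theorem dvd_of_cofactor {p : ℤ} (hp : p ≠ 0) {γ a y : L5} (h : γ * a = (p : L5))
    (hy : Dvdc p (a * y)) : γ ∣ y := by
  obtain ⟨z, hz⟩ := (dvd_iff_dvdc p _).2 hy
  have ha : a ≠ 0 := by
    rintro rfl
    rw [mul_zero] at h
    exact hp (by exact_mod_cast h.symm)
  refine ⟨z, mul_left_cancel₀ ha ?_⟩
  rw [hz, ← h]; ring

/-- Modulo `γ` every element is congruent to the integer given by the residues. -/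
theorem PCert.sub_dvd {p v1 v2 v3 v4 : ℤ} {γ a : L5} (hp : p ≠ 0) (h : PCert p v1 v2 v3 v4 γ a)
    (x : L5) : γ ∣ x - ((x.a + v1 * x.b + v2 * x.c + v3 * x.d + v4 * x.e : ℤ) : L5) := by
  obtain ⟨h0, h1, h2, h3, h4⟩ := h
  have e : x - ((x.a + v1 * x.b + v2 * x.c + v3 * x.d + v4 * x.e : ℤ) : L5)
      = (x.b : L5) * ⟨-v1, 1, 0, 0, 0⟩ + (x.c : L5) * ⟨-v2, 0, 1, 0, 0⟩
        + (x.d : L5) * ⟨-v3, 0, 0, 1, 0⟩ + (x.e : L5) * ⟨-v4, 0, 0, 0, 1⟩ := by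
    simp only [intCast_mul_eq]
    ext <;> simp only [sub_a, sub_b, sub_c, sub_d, sub_e, add_a, add_b, add_c, add_d, add_e,
      zcast_a, zcast_b, zcast_c, zcast_d, zcast_e] <;> ring
  rw [e]
  exact dvd_add (dvd_add (dvd_add (dvd_mul_of_dvd_right (dvd_of_cofactor hp h0 h1) _)
    (dvd_mul_of_dvd_right (dvd_of_cofactor hp h0 h2) _))
    (dvd_mul_of_dvd_right (dvd_of_cofactor hp h0 h3) _))
    (dvd_mul_of_dvd_right (dvd_of_cofactor hp h0 h4) _)

theorem PCert.dvd {p v1 v2 v3 v4 : ℤ} {γ a : L5} (hp : p ≠ 0) (h : PCert p v1 v2 v3 v4 γ a)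
    (x : L5) (hx : p ∣ x.a + v1 * x.b + v2 * x.c + v3 * x.d + v4 * x.e) : γ ∣ x := by
  have h1 := h.sub_dvd hp x
  have h2 : γ ∣ ((x.a + v1 * x.b + v2 * x.c + v3 * x.d + v4 * x.e : ℤ) : L5) := by
    obtain ⟨k, hk⟩ := hx
    rw [hk, Int.cast_mul, ← h.1]
    exact ⟨a * k, by ring⟩
  have := dvd_add h1 h2
  simpa using this

/-- Compatibility of residues with the multiplication table. -/
def Compat {R : Type*} [CommRing R] (v1 v2 v3 v4 : R) : Prop :=
  v1 * v1 = v2 ∧ v1 * v2 = -v2 + 2 * v3 ∧ v1 * v3 = -v1 + 2 * v4 ∧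
  v1 * v4 = 5 + 2 * v1 + 2 * v2 + 7 * v3 + 6 * v4 ∧
  v2 * v2 = -2 * v1 + v2 - 2 * v3 + 4 * v4 ∧
  v2 * v3 = 10 + 4 * v1 + 3 * v2 + 14 * v3 + 12 * v4 ∧
  v2 * v4 = 30 + 10 * v1 + 12 * v2 + 46 * v3 + 50 * v4 ∧
  v3 * v3 = 35 + 12 * v1 + 14 * v2 + 52 * v3 + 56 * v4 ∧
  v3 * v4 = 140 + 47 * v1 + 55 * v2 + 210 * v3 + 221 * v4 ∧
  v4 * v4 = 555 + 187 * v1 + 218 * v2 + 832 * v3 + 876 * v4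

/-- The homomorphism with given values on the basis. -/
def mkHom {R : Type*} [CommRing R] (v1 v2 v3 v4 : R) (h : Compat v1 v2 v3 v4) : L5 →+* R where
  toFun x := x.a + v1 * x.b + v2 * x.c + v3 * x.d + v4 * x.e
  map_one' := by simp
  map_zero' := by simp
  map_add' x y := by simp; ring
  map_mul' x y := by
    obtain ⟨h1, h2, h3, h4, h5, h6, h7, h8, h9, h10⟩ := h
    simp only [mul_a, mul_b, mul_c, mul_d, mul_e]
    push_cast
    linear_combination (-(x.b * y.b : R)) * h1 - (x.b * y.c + x.c * y.b : R) * h2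
      - (x.b * y.d + x.d * y.b : R) * h3 - (x.b * y.e + x.e * y.b : R) * h4
      - (x.c * y.c : R) * h5 - (x.c * y.d + x.d * y.c : R) * h6
      - (x.c * y.e + x.e * y.c : R) * h7 - (x.d * y.d : R) * h8
      - (x.d * y.e + x.e * y.d : R) * h9 - (x.e * y.e : R) * h10

theorem mkHom_apply {R : Type*} [CommRing R] (v1 v2 v3 v4 : R) (h : Compat v1 v2 v3 v4) (x : L5) :
    mkHom v1 v2 v3 v4 h x = x.a + v1 * x.b + v2 * x.c + v3 * x.d + v4 * x.e := rfl

instance {p : ℕ} (v1 v2 v3 v4 : ZMod p) : Decidable (Compat v1 v2 v3 v4) := by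
  unfold Compat; infer_instance

/-- Reduction modulo the prime of ramification index 4 above 2. -/
def phiQ2 : L5 →+* ZMod 2 := mkHom 0 0 1 1 (by decide)
/-- Reduction modulo the unramified prime above 2. -/
def phiP2 : L5 →+* ZMod 2 := mkHom 1 1 1 0 (by decide)
/-- Reduction modulo the prime of ramification index 2 above 3. -/
def phiP3 : L5 →+* ZMod 3 := mkHom 1 1 1 1 (by decide)
/-- Reduction modulo the prime of ramification index 3 above 3. -/
def phiQ3 : L5 →+* ZMod 3 := mkHom 2 1 0 1 (by decide)
/-- Reduction modulo the prime above 5. -/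
def phi5 : L5 →+* ZMod 5 := mkHom 0 0 0 0 (by decide)

def gQ2 : L5 := ⟨2, 1, 1, 3, 3⟩
def gP2 : L5 := ⟨-17, 18, 28, 21, -7⟩
def gP3 : L5 := ⟨7, 12, 5, 1, -1⟩
def gQ3 : L5 := ⟨3, -17, -15, -12, 4⟩
def gP5 : L5 := ⟨0, -4, -3, -2, 1⟩

theorem certQ2 : PCert 2 0 0 1 1 gQ2 ⟨51, 17, 17, 51, -14⟩ := by decide
theorem certP2 : PCert 2 1 1 1 0 gP2 ⟨-196, -66, -77, -294, -310⟩ := by decide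
theorem certP3 : PCert 3 1 1 1 1 gP3 ⟨874, 370, 247, 886, -241⟩ := by decide
theorem certQ3 : PCert 3 2 1 0 1 gQ3 ⟨301, 151, 59, 346, -92⟩ := by decide
theorem certP5 : PCert 5 0 0 0 0 gP5 ⟨625, 288, 151, 673, -181⟩ := by decide

theorem phiQ2_dvd (x : L5) (h : phiQ2 x = 0) : gQ2 ∣ x := by
  refine certQ2.dvd (by norm_num) x ?_
  refine (ZMod.intCast_zmod_eq_zero_iff_dvd _ 2).1 ?_
  rw [← h]
  simp [phiQ2, mkHom_apply]

theorem phiP2_dvd (x : L5) (h : phiP2 x = 0) : gP2 ∣ x := by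
  refine certP2.dvd (by norm_num) x ?_
  refine (ZMod.intCast_zmod_eq_zero_iff_dvd _ 2).1 ?_
  rw [← h]
  simp [phiP2, mkHom_apply]

theorem phiP3_dvd (x : L5) (h : phiP3 x = 0) : gP3 ∣ x := by
  refine certP3.dvd (by norm_num) x ?_
  refine (ZMod.intCast_zmod_eq_zero_iff_dvd _ 3).1 ?_
  rw [← h]
  simp [phiP3, mkHom_apply]

theorem phiQ3_dvd (x : L5) (h : phiQ3 x = 0) : gQ3 ∣ x := by
  refine certQ3.dvd (by norm_num) x ?_
  refine (ZMod.intCast_zmod_eq_zero_iff_dvd _ 3).1 ?_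
  rw [← h]
  simp [phiQ3, mkHom_apply]

theorem phi5_dvd (x : L5) (h : phi5 x = 0) : gP5 ∣ x := by
  refine certP5.dvd (by norm_num) x ?_
  refine (ZMod.intCast_zmod_eq_zero_iff_dvd _ 5).1 ?_
  rw [← h]
  simp [phi5, mkHom_apply]

theorem two_eq : (2 : L5) = gQ2 ^ 4 * gP2 * ⟨90359, 44197, 18972, 101923, -27191⟩ := by decide
theorem three_eq : (3 : L5) = gP3 ^ 2 * gQ3 ^ 3 *
    ⟨-5204321949, -2689890876, -932566282, -6122075316, 1621557344⟩ := by decide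
theorem five_eq : (5 : L5) = gP5 ^ 5 *
    ⟨-1674364809, -674843990, -511450983, -1637379289, 448489373⟩ := by decide

end L5

open L5

/-- `y` can be cancelled from integrality statements. -/
def Strip (y : L5) : Prop :=
  ∀ x : K5, IsIntegral ℤ x → iota y * x ∈ iota.range → x ∈ iota.range

noncomputable instance algL5K5 : Algebra L5 K5 := iota.toAlgebra

theorem algebraMap_L5 : algebraMap L5 K5 = iota := rfl

theorem iota_integral (y : L5) : IsIntegral ℤ (iota y) := by
  have : Module.Finite ℤ L5 := by
    refine ⟨⟨{⟨1, 0, 0, 0, 0⟩, ⟨0, 1, 0, 0, 0⟩, ⟨0, 0, 1, 0, 0⟩, ⟨0, 0, 0, 1, 0⟩, ⟨0, 0, 0, 0, 1⟩}, ?_⟩⟩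
    rw [eq_top_iff]
    intro x _
    have e : x = x.a • (⟨1, 0, 0, 0, 0⟩ : L5) + x.b • (⟨0, 1, 0, 0, 0⟩ : L5)
      + x.c • (⟨0, 0, 1, 0, 0⟩ : L5) + x.d • (⟨0, 0, 0, 1, 0⟩ : L5)
      + x.e • (⟨0, 0, 0, 0, 1⟩ : L5) := by
        ext <;> simp only [add_a, add_b, add_c, add_d, add_e, zsm_a, zsm_b, zsm_c, zsm_d, zsm_e] <;>
          ring
    rw [e]
    refine Submodule.add_mem _ (Submodule.add_mem _ (Submodule.add_mem _ (Submodule.add_mem _ ?_ ?_) ?_) ?_) ?_ <;>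
    refine Submodule.smul_mem _ _ (Submodule.subset_span ?_) <;> simp
  have h : IsIntegral ℤ y := Algebra.IsIntegral.isIntegral y
  exact h.map iota.toIntAlgHom

theorem Strip.mul {y z : L5} (hy : Strip y) (hz : Strip z) : Strip (y * z) := by
  intro x hx h
  rw [map_mul, mul_assoc] at h
  exact hz x hx (hy _ ((iota_integral z).mul hx) h)

theorem Strip.pow {y : L5} (hy : Strip y) (n : ℕ) : Strip (y ^ n) := by
  induction n with
  | zero => intro x _ h; simpa using h
  | succ n ih => rw [pow_succ]; exact ih.mul hy

theorem strip_unit (y z : L5) (h : y * z = 1) : Strip y := by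
  rintro x _ ⟨w, hw⟩
  refine ⟨z * w, ?_⟩
  rw [map_mul, hw, ← mul_assoc, ← map_mul, mul_comm z y, h, map_one, one_mul]

theorem strip_of_hom {F : Type*} [Field F] (φ : L5 →+* F) (γ : L5) (hγ : γ ≠ 0) (h0 : φ γ = 0)
    (h : ∀ x, φ x = 0 → γ ∣ x) : Strip γ := by
  rintro x hx ⟨y, hy⟩
  obtain ⟨P, hP, hPx⟩ := hx
  let P' : Polynomial L5 := P.map (Int.castRingHom L5)
  have hP' : P'.Monic := hP.map _
  have hPx' : Polynomial.eval₂ iota x P' = 0 := by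
    rw [Polynomial.eval₂_map]
    rw [← hPx]
    congr 1
    exact RingHom.ext_int _ _
  have h1 : Polynomial.eval₂ iota (iota γ * x) (P'.scaleRoots γ) = 0 :=
    Polynomial.scaleRoots_eval₂_eq_zero iota hPx'
  rw [← hy, Polynomial.eval₂_at_apply] at h1
  have h2 : (P'.scaleRoots γ).eval y = 0 := iota_injective (by rw [h1, map_zero])
  have h3 : φ y ^ P'.natDegree = 0 := by
    have h4 := congrArg φ h2
    rw [map_zero, ← Polynomial.eval₂_at_apply, ← Polynomial.eval_map] at h4
    rw [Polynomial.map_scaleRoots _ _ _ (by rw [hP'.leadingCoeff, map_one]; exact one_ne_zero), h0,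
      Polynomial.scaleRoots_zero] at h4
    simpa [(hP'.map φ).leadingCoeff, hP'.natDegree_map] using h4
  obtain ⟨w, hw⟩ := h y (eq_zero_of_pow_eq_zero h3)
  refine ⟨w, mul_left_cancel₀ (fun hh => hγ (iota_injective (hh.trans (map_zero iota).symm))) ?_⟩
  rw [← map_mul, ← hw, hy]

theorem strip_two : Strip 2 := by
  rw [two_eq]
  exact (((strip_of_hom phiQ2 gQ2 (by decide) (by decide) phiQ2_dvd).pow 4).mul
    (strip_of_hom phiP2 gP2 (by decide) (by decide) phiP2_dvd)).mul
    (strip_unit _ ⟨-334736, -112727, -131516, -501932, -528779⟩ (by decide))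

theorem strip_three : Strip 3 := by
  rw [three_eq]
  exact (((strip_of_hom phiP3 gP3 (by decide) (by decide) phiP3_dvd).pow 2).mul
    ((strip_of_hom phiQ3 gQ3 (by decide) (by decide) phiQ3_dvd).pow 3)).mul
    (strip_unit _ ⟨852891, 1333492, 526446, 99340, -64336⟩ (by decide))

theorem strip_five : Strip 5 := by
  rw [five_eq]
  exact ((strip_of_hom phi5 gP5 (by decide) (by decide) phi5_dvd).pow 5).mul
    (strip_unit _ ⟨338704576, 114063258, 133075399, 507883654, 535048811⟩ (by decide))

theorem strip_sixty : Strip 60 := by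
  have e : (60 : L5) = 2 ^ 2 * 3 * 5 := by norm_num
  rw [e]
  exact ((strip_two.pow 2).mul strip_three).mul strip_five

open L5

/-- The power basis of `K5`. -/
noncomputable def bK5 : Module.Basis (Fin 5) ℚ K5 :=
  (AdjoinRoot.powerBasis gQ5_monic.ne_zero).basis.reindex
    (finCongr (by rw [AdjoinRoot.powerBasis_dim, gQ5_natDegree]))

theorem bK5_apply (i : Fin 5) : bK5 i = t5 ^ (i : ℕ) := by
  simp [bK5, t5]

theorem bK5_repr (x : K5) (q : Fin 5 → ℚ) (h : x = ∑ i, q i • t5 ^ (i : ℕ)) (i : Fin 5) :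
    bK5.repr x i = q i := by
  have : x = ∑ i, q i • bK5 i := by simpa only [bK5_apply] using h
  rw [this, Module.Basis.repr_sum_self]

theorem t5_pow6 : t5 ^ 6 = 45 * t5 ^ 4 + 120 * t5 ^ 3 + 120 * t5 ^ 2 + 120 * t5 + 100 := by
  linear_combination (t5 + 5) * t5_eq
theorem t5_pow7 : t5 ^ 7 = 345 * t5 ^ 4 + 1020 * t5 ^ 3 + 1020 * t5 ^ 2 + 1000 * t5 + 900 := by
  linear_combination t5 * t5_pow6 + 45 * t5_eq
theorem t5_pow8 : t5 ^ 8 = 2745 * t5 ^ 4 + 7920 * t5 ^ 3 + 7900 * t5 ^ 2 + 7800 * t5 + 6900 := by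
  linear_combination t5 * t5_pow7 + 345 * t5_eq

theorem trace_aux (x : K5) : Algebra.trace ℚ K5 x = ∑ i : Fin 5, bK5.repr (x * t5 ^ (i : ℕ)) i := by
  rw [Algebra.trace_eq_matrix_trace bK5, Matrix.trace]
  simp [Algebra.leftMulMatrix_eq_repr_mul, bK5_apply]

theorem repr0 (i : Fin 5) : bK5.repr (t5 ^ 0) i = (![1, 0, 0, 0, 0] : Fin 5 → ℚ) i :=
  bK5_repr _ ![1, 0, 0, 0, 0] (by simp [Fin.sum_univ_five]) i
theorem repr1 (i : Fin 5) : bK5.repr (t5 ^ 1) i = (![0, 1, 0, 0, 0] : Fin 5 → ℚ) i :=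
  bK5_repr _ ![0, 1, 0, 0, 0] (by simp [Fin.sum_univ_five]) i
theorem repr2 (i : Fin 5) : bK5.repr (t5 ^ 2) i = (![0, 0, 1, 0, 0] : Fin 5 → ℚ) i :=
  bK5_repr _ ![0, 0, 1, 0, 0] (by simp [Fin.sum_univ_five]) i
theorem repr3 (i : Fin 5) : bK5.repr (t5 ^ 3) i = (![0, 0, 0, 1, 0] : Fin 5 → ℚ) i :=
  bK5_repr _ ![0, 0, 0, 1, 0] (by simp [Fin.sum_univ_five]) i
theorem repr4 (i : Fin 5) : bK5.repr (t5 ^ 4) i = (![0, 0, 0, 0, 1] : Fin 5 → ℚ) i :=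
  bK5_repr _ ![0, 0, 0, 0, 1] (by simp [Fin.sum_univ_five]) i
theorem repr5 (i : Fin 5) : bK5.repr (t5 ^ 5) i = (![20, 20, 20, 20, 5] : Fin 5 → ℚ) i :=
  bK5_repr _ ![20, 20, 20, 20, 5] (by rw [t5_eq]; simp [Fin.sum_univ_five, Algebra.smul_def]; ring) i
theorem repr6 (i : Fin 5) : bK5.repr (t5 ^ 6) i = (![100, 120, 120, 120, 45] : Fin 5 → ℚ) i :=
  bK5_repr _ ![100, 120, 120, 120, 45] (by rw [t5_pow6]; simp [Fin.sum_univ_five, Algebra.smul_def]; ring) i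
theorem repr7 (i : Fin 5) : bK5.repr (t5 ^ 7) i = (![900, 1000, 1020, 1020, 345] : Fin 5 → ℚ) i :=
  bK5_repr _ ![900, 1000, 1020, 1020, 345] (by rw [t5_pow7]; simp [Fin.sum_univ_five, Algebra.smul_def]; ring) i
theorem repr8 (i : Fin 5) : bK5.repr (t5 ^ 8) i = (![6900, 7800, 7900, 7920, 2745] : Fin 5 → ℚ) i :=
  bK5_repr _ ![6900, 7800, 7900, 7920, 2745] (by rw [t5_pow8]; simp [Fin.sum_univ_five, Algebra.smul_def]; ring) i

theorem trace_pow (k : Fin 5) :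
    Algebra.trace ℚ K5 (t5 ^ (k : ℕ)) = (![5, 5, 65, 485, 3905] : Fin 5 → ℚ) k := by
  rw [trace_aux]
  have e : ∀ i : Fin 5, bK5.repr (t5 ^ (k : ℕ) * t5 ^ (i : ℕ)) i
      = bK5.repr (t5 ^ ((k : ℕ) + (i : ℕ))) i := fun i => by rw [pow_add]
  simp only [e, Fin.sum_univ_five]
  fin_cases k <;>
    simp only [Fin.zero_eta, Fin.mk_one, Fin.reduceFinMk, Fin.val_zero, Fin.val_one, Fin.val_two,
      Fin.coe_ofNat_eq_mod, Nat.reduceMod, Nat.reduceAdd, zero_add,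
      repr0, repr1, repr2, repr3, repr4, repr5, repr6, repr7, repr8] <;>
    simp <;> norm_num

/-- The trace form on `L5`. -/
def tr5 (y : L5) : ℤ := 5 * y.a + 5 * y.b + 65 * y.c + 275 * y.d + 1100 * y.e

theorem trace_iota (y : L5) : Algebra.trace ℚ K5 (iota y) = tr5 y := by
  have e : iota y = (y.a : ℚ) • t5 ^ ((0 : Fin 5) : ℕ) + ((y.b : ℚ) + y.e / 2) • t5 ^ ((1 : Fin 5) : ℕ)
    + ((y.c : ℚ) + y.d / 2) • t5 ^ ((2 : Fin 5) : ℕ) + ((y.d : ℚ) / 2 + y.e / 4) • t5 ^ ((3 : Fin 5) : ℕ)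
    + ((y.e : ℚ) / 4) • t5 ^ ((4 : Fin 5) : ℕ) := by
    rw [iota_apply]
    simp [Algebra.smul_def]
    ring
  rw [e]
  simp only [map_add, map_smul, trace_pow]
  simp [tr5]
  ring

/-- Every algebraic integer of `K5` lies in `L5`. -/
theorem mem_range_of_integral (x : K5) (hx : IsIntegral ℤ x) : x ∈ iota.range := by
  obtain ⟨n, y, hn, hy⟩ := exists_denom x
  have hn' : (n : K5) ≠ 0 := by exact_mod_cast hn
  have key : ∀ w : L5, n ∣ tr5 (y * w) := by
    intro w
    have h1 : IsIntegral ℤ (Algebra.trace ℚ K5 (x * iota w)) :=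
      Algebra.isIntegral_trace (hx.mul (iota_integral w))
    obtain ⟨m, hm⟩ := IsIntegrallyClosed.isIntegral_iff.1 h1
    refine ⟨m, ?_⟩
    have h2 : (n : ℚ) • (x * iota w) = iota (y * w) := by
      rw [map_mul, ← hy, Algebra.smul_def]; simp [mul_assoc]
    have h3 := congrArg (Algebra.trace ℚ K5) h2
    rw [map_smul, trace_iota, ← hm] at h3
    simp at h3
    exact_mod_cast h3.symm
  have k0 := key ⟨1, 0, 0, 0, 0⟩
  have k1 := key ⟨0, 1, 0, 0, 0⟩
  have k2 := key ⟨0, 0, 1, 0, 0⟩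
  have k3 := key ⟨0, 0, 0, 1, 0⟩
  have k4 := key ⟨0, 0, 0, 0, 1⟩
  obtain ⟨m0, k0⟩ := k0
  obtain ⟨m1, k1⟩ := k1
  obtain ⟨m2, k2⟩ := k2
  obtain ⟨m3, k3⟩ := k3
  obtain ⟨m4, k4⟩ := k4
  simp only [tr5, mul_a, mul_b, mul_c, mul_d, mul_e] at k0 k1 k2 k3 k4
  have h60 : (n : L5) * ⟨-370*m0 - 209*m1 - 73*m2 - 444*m3 + 118*m4,
      -209*m0 - 128*m1 - 46*m2 - 231*m3 + 62*m4, -73*m0 - 46*m1 - 12*m2 - 75*m3 + 20*m4,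
      -444*m0 - 231*m1 - 75*m2 - 514*m3 + 136*m4,
      118*m0 + 62*m1 + 20*m2 + 136*m3 - 36*m4⟩ = ((60 : ℤ) : L5) * y := by
    rw [intCast_mul_eq, intCast_mul_eq]
    ext <;> simp only <;> linarith
  refine strip_sixty x hx ⟨⟨-370*m0 - 209*m1 - 73*m2 - 444*m3 + 118*m4,
      -209*m0 - 128*m1 - 46*m2 - 231*m3 + 62*m4, -73*m0 - 46*m1 - 12*m2 - 75*m3 + 20*m4,
      -444*m0 - 231*m1 - 75*m2 - 514*m3 + 136*m4,
      118*m0 + 62*m1 + 20*m2 + 136*m3 - 36*m4⟩, mul_left_cancel₀ hn' ?_⟩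
  have h := congrArg iota h60
  rw [map_mul, map_mul, map_intCast, map_intCast] at h
  rw [h, ← hy]
  have : iota 60 = 60 := map_ofNat iota 60
  rw [this]
  push_cast
  ring

theorem isIntegralClosure_L5 [inst : Algebra ℤ K5] : @IsIntegralClosure L5 ℤ K5 _ _ _ inst _ :=
  have h : inst = Ring.toIntAlgebra K5 := Subsingleton.elim _ _
  { algebraMap_injective := iota_injective
    isIntegral_iff := by
      intro x
      subst h
      constructor
      · intro hx
        obtain ⟨y, hy⟩ := mem_range_of_integral x hx
        exact ⟨y, hy⟩
      · rintro ⟨y, rfl⟩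
        exact iota_integral y }

open NumberField in
/-- The ring of integers of `K5` is `L5`. -/
noncomputable def e5 : 𝓞 K5 ≃+* L5 :=
  haveI := @isIntegralClosure_L5 (Ring.toIntAlgebra K5)
  NumberField.RingOfIntegers.equiv L5

open L5

theorem e5_coe (x : NumberField.RingOfIntegers K5) : iota (e5 x) = (x : K5) := by
  obtain ⟨y, rfl⟩ := e5.symm.surjective x
  rw [RingEquiv.apply_symm_apply]
  have inst := @isIntegralClosure_L5 (Ring.toIntAlgebra K5)
  exact (@IsIntegralClosure.algebraMap_equiv ℤ L5 K5 _ _ _ (Ring.toIntAlgebra K5) _ inst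
    (NumberField.RingOfIntegers K5) _ _ _ _ _ _ _ y).symm

/-- Coordinates on `L5`. -/
def coordL5 : L5 ≃ₗ[ℤ] (Fin 5 → ℤ) where
  toFun x := ![x.a, x.b, x.c, x.d, x.e]
  invFun v := ⟨v 0, v 1, v 2, v 3, v 4⟩
  map_add' x y := by ext i; fin_cases i <;> simp
  map_smul' n x := by ext i; fin_cases i <;> simp [-zsmul_eq_mul]
  left_inv x := rfl
  right_inv v := by ext i; fin_cases i <;> rfl

/-- The standard integral basis of the ring of integers. -/
noncomputable def basisO : Module.Basis (Fin 5) ℤ (NumberField.RingOfIntegers K5) :=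
  (Module.Basis.ofEquivFun coordL5).map (e5.symm.toAddEquiv.toIntLinearEquiv)

theorem e5_basisO (i : Fin 5) : e5 (basisO i) =
    (![⟨1, 0, 0, 0, 0⟩, ⟨0, 1, 0, 0, 0⟩, ⟨0, 0, 1, 0, 0⟩, ⟨0, 0, 0, 1, 0⟩, ⟨0, 0, 0, 0, 1⟩] : Fin 5 → L5) i := by
  have : e5 (basisO i) = coordL5.symm (Pi.single i 1) := by
    simp [basisO]
  rw [this]
  fin_cases i <;> rfl

theorem trace_int (x : NumberField.RingOfIntegers K5) :
    Algebra.trace ℤ (NumberField.RingOfIntegers K5) x = tr5 (e5 x) := by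
  have h := Algebra.coe_trace_int x
  rw [← e5_coe, trace_iota] at h
  exact_mod_cast h

theorem discr_K5 : NumberField.discr K5 = 16200000 := by
  rw [← NumberField.discr_eq_discr K5 basisO, Algebra.discr_def]
  have e : Algebra.traceMatrix ℤ basisO = !![5,5,65,275,1100; 5,65,485,2195,8690;
      65,485,3905,17315,68630; 275,2195,17315,77045,305360; 1100,8690,68630,305360,1210280] := by
    ext i j
    rw [Algebra.traceMatrix_apply, Algebra.traceForm_apply, trace_int, map_mul, e5_basisO, e5_basisO]
    fin_cases i <;> fin_cases j <;> decide
  rw [e]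
  simp [Matrix.det_succ_row_zero, Fin.sum_univ_succ, Fin.succAbove]

theorem real_root_gt (x : ℝ) (h : x ^ 5 = 5 * x ^ 4 + 20 * x ^ 3 + 20 * x ^ 2 + 20 * x + 20) :
    7 < x := by
  by_contra! hx
  rcases le_or_gt 0 x with h0 | h0
  · have h1 : x ^ 2 - 5 * x - 20 ≤ 0 := by nlinarith
    nlinarith [mul_nonneg (pow_nonneg h0 3) (neg_nonneg.2 h1), pow_nonneg h0 2]
  · have hs : 0 ≤ -x := by linarith
    nlinarith [mul_nonneg (pow_nonneg hs 3) (sq_nonneg (-x - 77/50)),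
      mul_nonneg (pow_nonneg hs 2) (sq_nonneg (-x - 77/50)),
      mul_nonneg (pow_nonneg hs 1) (sq_nonneg (-x - 77/50)), sq_nonneg (-x - 77/50), sq_nonneg (-x - 1.5)]

theorem real_root_unique (x y : ℝ)
    (hx : x ^ 5 = 5 * x ^ 4 + 20 * x ^ 3 + 20 * x ^ 2 + 20 * x + 20)
    (hy : y ^ 5 = 5 * y ^ 4 + 20 * y ^ 3 + 20 * y ^ 2 + 20 * y + 20) : x = y := by
  have key : ∀ x y : ℝ, 7 < x → x < y →
      x ^ 5 - (5 * x ^ 4 + 20 * x ^ 3 + 20 * x ^ 2 + 20 * x + 20) <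
      y ^ 5 - (5 * y ^ 4 + 20 * y ^ 3 + 20 * y ^ 2 + 20 * y + 20) := by
    intro x y h1 h2
    obtain ⟨s, rfl⟩ : ∃ s, x = 7 + s := ⟨x - 7, by ring⟩
    obtain ⟨d, rfl⟩ : ∃ d, y = 7 + s + d := ⟨y - (7 + s), by ring⟩
    have hs : 0 < s := by linarith
    have hd : 0 < d := by linarith
    rw [← sub_pos]
    ring_nf
    positivity
  have h1 := real_root_gt x hx
  have h2 := real_root_gt y hy
  rcases lt_trichotomy x y with h | h | h
  · have := key x y h1 h; linarith
  · exact h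
  · have := key y x h2 h; linarith

open NumberField NumberField.InfinitePlace in
theorem nrReal_K5 : nrRealPlaces K5 = 1 := by
  classical
  apply le_antisymm
  · rw [← card_real_embeddings, Fintype.card_le_one_iff]
    have hr : ∀ φ : K5 →+* ℂ, ComplexEmbedding.IsReal φ → ∃ x : ℝ, φ t5 = x ∧
        x ^ 5 = 5 * x ^ 4 + 20 * x ^ 3 + 20 * x ^ 2 + 20 * x + 20 := by
      intro φ hφ
      have h1 : (starRingEnd ℂ) (φ t5) = φ t5 := by
        have := RingHom.congr_fun hφ t5
        simpa using this
      obtain ⟨x, hx⟩ := Complex.conj_eq_iff_real.1 h1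
      refine ⟨x, hx, ?_⟩
      have h2 := congrArg φ t5_eq
      simp only [map_add, map_mul, map_pow, map_ofNat, hx] at h2
      exact_mod_cast h2
    rintro ⟨φ, hφ⟩ ⟨ψ, hψ⟩
    obtain ⟨x, hx, hx'⟩ := hr φ hφ
    obtain ⟨y, hy, hy'⟩ := hr ψ hψ
    have hxy := real_root_unique x y hx' hy'
    apply Subtype.ext
    apply RingHom.ext
    intro z
    obtain ⟨q, rfl⟩ := t5_span z
    simp only [map_sum, Algebra.smul_def, map_mul, map_pow, hx, hy, hxy]
    simp
  · exact nrRealPlaces_pos_of_odd_finrank (by rw [finrank_K5]; decide)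

open NumberField NumberField.InfinitePlace in
theorem nrComplex_K5 : nrComplexPlaces K5 = 2 := by
  have := card_add_two_mul_card_eq_rank K5
  rw [finrank_K5, nrReal_K5] at this
  omega

theorem minkowski_K5 : (4 / Real.pi) ^ 2 * ((Nat.factorial 5 : ℝ) / 5 ^ 5 * Real.sqrt |(16200000 : ℝ)|) < 251 := by
  have hpi : 3.14159 < Real.pi := Real.pi_gt_d6.trans_le' (by norm_num)
  have h1 : Real.sqrt |(16200000 : ℝ)| < 4024.93 := by
    rw [Real.sqrt_lt' (by norm_num)]; norm_num
  have h2 : (4 / Real.pi) < 4 / 3.14159 := by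
    apply div_lt_div_of_pos_left <;> norm_num at hpi ⊢ <;> exact hpi
  have h3 : (4 / Real.pi) ^ 2 ≤ (4 / 3.14159) ^ 2 :=
    pow_le_pow_left₀ (by positivity) h2.le 2
  have h4 : (Nat.factorial 5 : ℝ) / 5 ^ 5 * Real.sqrt |(16200000 : ℝ)| ≤ 120 / 3125 * 4024.93 := by
    have : (Nat.factorial 5 : ℝ) = 120 := by norm_num [Nat.factorial]
    rw [this]
    norm_num at h1 ⊢
    linarith
  calc _ ≤ (4 / 3.14159) ^ 2 * (120 / 3125 * 4024.93) := by gcongr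
    _ < (251 : ℝ) := by norm_num

open NumberField NumberField.InfinitePlace in
theorem pid_of (h : ∀ P : Ideal L5, P.IsPrime → 0 < Nat.card (L5 ⧸ P) → Nat.card (L5 ⧸ P) ≤ 250 →
    ∃ γ, P = Ideal.span {γ}) : IsPrincipalIdealRing L5 := by
  have h1 : IsPrincipalIdealRing (𝓞 K5) := by
    apply RingOfIntegers.isPrincipalIdealRing_of_isPrincipal_of_norm_le_of_isPrime
    intro I hI hn
    rw [nrComplex_K5, discr_K5, finrank_K5] at hn
    have hlt : ((Ideal.absNorm (I : Ideal (𝓞 K5)) : ℕ) : ℝ) < 251 := by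
      refine lt_of_le_of_lt hn ?_
      have := minkowski_K5
      push_cast at this ⊢
      exact this
    have hlt' : Ideal.absNorm (I : Ideal (𝓞 K5)) < 251 := by exact_mod_cast hlt
    obtain ⟨γ, hγ⟩ := h ((I : Ideal (𝓞 K5)).map (e5 : 𝓞 K5 →+* L5)) (Ideal.map_isPrime_of_equiv e5) (by
      have h0 := Ideal.absNorm_pos_of_nonZeroDivisors I
      rw [Ideal.absNorm_apply, Submodule.cardQuot_apply] at h0
      rwa [← Nat.card_congr (Ideal.quotientEquiv (I : Ideal (𝓞 K5)) _ e5 rfl).toEquiv]) (by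
      rw [Ideal.absNorm_apply, Submodule.cardQuot_apply] at hlt'
      rw [← Nat.card_congr (Ideal.quotientEquiv (I : Ideal (𝓞 K5)) _ e5 rfl).toEquiv]
      omega)
    refine ⟨e5.symm γ, ?_⟩
    have h2 := congrArg (Ideal.map (e5.symm : L5 →+* 𝓞 K5)) hγ
    rw [Ideal.map_span, Set.image_singleton, Ideal.map_map] at h2
    simpa using! h2
  exact IsPrincipalIdealRing.of_surjective (e5 : 𝓞 K5 →+* L5) e5.surjective

open L5

/-- `P` has residue characteristic `p`. -/
def HasChar (P : Ideal L5) (p : ℕ) : Prop := ∀ n : ℤ, (n : L5) ∈ P ↔ (p : ℤ) ∣ n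

theorem span_of_cert {P : Ideal L5} {p : ℕ} (hp0 : p ≠ 0) (hP : HasChar P p) {v1 v2 v3 v4 : ℤ}
    {γ a : L5} (hc : PCert p v1 v2 v3 v4 γ a) (hγ : γ ∈ P) : P = Ideal.span {γ} := by
  apply le_antisymm
  · intro x hx
    rw [Ideal.mem_span_singleton]
    have hp : (p : ℤ) ≠ 0 := by exact_mod_cast hp0
    refine hc.dvd hp x ((hP _).1 ?_)
    have h1 := P.mem_of_dvd (hc.sub_dvd hp x) hγ
    have := P.sub_mem hx h1
    simpa using this
  · rw [Ideal.span_singleton_le_iff_mem]; exact hγ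

/-- Degree one primes: `(p, r, γ, a)` where `γ a = p` and `θ ≡ r` modulo `γ`. -/
def certs : List (ℕ × ℤ × L5 × L5) := [
  (7, 8, ⟨-3, -2, 0, -4, 2⟩, ⟨-89, -6, 52, 76, -22⟩),
  (13, 16, ⟨148, 31, 77, 95, -28⟩, ⟨-14074, -10033, 597, 5085, -1232⟩),
  (13, 44, ⟨3, 2, 0, 0, 0⟩, ⟨-209, -106, -44, -240, 64⟩),
  (13, 20, ⟨-3, -1, -1, -4, -4⟩, ⟨69, 69, 11, 138, -36⟩),
  (23, 32, ⟨8, 3, 3, 11, 12⟩, ⟨2046, 1033, 361, 2387, -632⟩),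
  (29, 60, ⟨-4, -2, -1, -4, 1⟩, ⟨49, 84, 43, 71, -21⟩),
  (29, 52, ⟨-1, 1, 1, 0, 0⟩, ⟨231, 131, 29, 306, -80⟩),
  (31, 16, ⟨74, -80, -106, -101, 32⟩, ⟨-5186, -2660, -952, -6065, 1608⟩),
  (31, 28, ⟨34, 3, -7, 41, -10⟩, ⟨-56, -19, -21, -83, -78⟩),
  (37, 40, ⟨-52, -29, 8, 22, -7⟩, ⟨-2801, 2425, -4798, 3457, -615⟩),
  (41, 48, ⟨-4, -25, -17, -11, 4⟩, ⟨4466, 2519, 567, 5619, -1472⟩),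
  (43, 140, ⟨-18, -10, -2, -23, 6⟩, ⟨-46, -102, -44, 5, 2⟩),
  (59, 152, ⟨31, 86, 48, 24, -10⟩, ⟨27729, 11026, 8636, 26856, -7370⟩),
  (59, 164, ⟨4, 1, 0, 4, -1⟩, ⟨-149, -73, -28, -217, 57⟩),
  (73, 184, ⟨8, 0, 3, 16, 17⟩, ⟨19601, 9742, 3967, 22355, -5953⟩),
  (79, 120, ⟨184, 62, 72, 275, 290⟩, ⟨1256, -286, 1154, -121, -34⟩),
  (107, 116, ⟨2, -1, 0, 4, -1⟩, ⟨-79, -25, 14, -117, 29⟩),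
  (107, 168, ⟨12, -1, -8, -10, 3⟩, ⟨3651, 2079, 438, 4629, -1211⟩),
  (107, 424, ⟨3, 2, 1, 3, -1⟩, ⟨-286, -254, -75, -288, 79⟩),
  (109, 264, ⟨-4, -1, -1, -5, -6⟩, ⟨-26, -197, 263, -315, 66⟩),
  (109, 280, ⟨-29, -10, -11, -43, -43⟩, ⟨144, -32, 233, 1252, -329⟩),
  (113, 256, ⟨-48, -16, -19, -72, -77⟩, ⟨-1381, -158, 193, -783, 189⟩),
  (113, 292, ⟨93, 114, 33, -7, -1⟩, ⟨16776, 8514, 3179, 19462, -5167⟩),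
  (113, 188, ⟨3, 7, 4, 3, -1⟩, ⟨-1394, -769, -208, -1698, 447⟩),
  (127, 200, ⟨57, 13, 19, 86, 94⟩, ⟨108991, 55929, 19989, 127480, -33798⟩),
  (131, 16, ⟨16, 10, 1, 22, -5⟩, ⟨-1979, -3238, -1347, -355, 191⟩),
  (131, 84, ⟨-16, -5, 5, 7, -2⟩, ⟨774, 433, 107, 967, -254⟩),
  (137, 68, ⟨-118, -39, 40, 68, -19⟩, ⟨-47979, -26297, -6934, -59053, 15525⟩),
  (139, 332, ⟨1, 2, 1, 1, -1⟩, ⟨-2156, -1134, -419, -2446, 651⟩),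
  (139, 412, ⟨9, 3, 4, 15, 15⟩, ⟨-8124, -3917, -1658, -9098, 2425⟩),
  (149, 68, ⟨31, 49, 8, -29, -25⟩, ⟨-544286, -288855, -89172, -653406, 172483⟩),
  (149, 540, ⟨-74, -25, -29, -111, -116⟩, ⟨3204, 1087, 195, 3243, -840⟩),
  (163, 4, ⟨-3, -5, 1, -8, 2⟩, ⟨79, 59, 11, 2, -2⟩),
  (167, 124, ⟨-68, -50, 2, 25, -6⟩, ⟨-2684, -1390, -476, -3163, 838⟩),
  (173, 600, ⟨3, 1, 1, 4, 2⟩, ⟨-49, 415, 349, -98, 2⟩),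
  (179, 572, ⟨-119, -68, -10, -146, 38⟩, ⟨-101, -24, -30, -138, -170⟩),
  (181, 408, ⟨-6, -28, -18, -11, 4⟩, ⟨554, 144, 260, 395, -116⟩),
  (191, 264, ⟨-106, -342, -202, -111, 42⟩, ⟨9554, 1214, 5844, 4745, -1546⟩),
  (191, 560, ⟨-34, -16, -8, -37, 10⟩, ⟨746, 1344, 606, 243, -106⟩),
  (197, 252, ⟨103, 55, 31, 110, -30⟩, ⟨-101, -47, -37, -132, -126⟩),
  (197, 300, ⟨2, 1, 2, 6, 5⟩, ⟨-4659, -1723, -1530, -4287, 1185⟩),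
  (197, 700, ⟨2, 1, 0, 0, 1⟩, ⟨1701, 599, 526, 1551, -427⟩),
  (199, 624, ⟨49, 22, 12, 52, -14⟩, ⟨251, 114, -64, -156, 42⟩),
  (199, 284, ⟨14, 5, 19, 59, 48⟩, ⟨-127424, -40489, -50975, -105661, 29956⟩),
  (211, 264, ⟨324, 199, 23, 433, -122⟩, ⟨-101546, 65321, 111037, 113849, -35398⟩),
  (211, 132, ⟨-21, -7, -8, -31, -33⟩, ⟨654, 165, 654, 492, -163⟩),
  (223, 32, ⟨-3, 5, -8, -1, -27⟩, ⟨10014, -26727, -26682, -22620, 7403⟩),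
  (227, 692, ⟨22, 14, 2, 7, -2⟩, ⟨-214, -126, -36, -269, 74⟩),
  (229, 764, ⟨-1, -4, -3, -3, 1⟩, ⟨736, 478, 29, 980, -253⟩),
  (229, 556, ⟨16, 16, -6, 19, -46⟩, ⟨3104, 58312, 43336, 30277, -10518⟩),
  (233, 664, ⟨-2, -1, 0, -2, 3⟩, ⟨431, -273, -164, 919, -221⟩)]

/-- The value `(r² + r³)/2`. -/
def cv3 (r : ℤ) : ℤ := (r ^ 2 + r ^ 3) / 2
/-- The value `(2 r + r³ + r⁴)/4`. -/
def cv4 (r : ℤ) : ℤ := (2 * r + r ^ 3 + r ^ 4) / 4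

theorem certs_ok : ∀ c ∈ certs, PCert c.1 c.2.1 (c.2.1 ^ 2) (cv3 c.2.1) (cv4 c.2.1) c.2.2.1 c.2.2.2 ∧
    (4 : ℤ) ∣ c.2.1 ∧ (c.1 : ℤ) ∣ c.2.2.1.a + c.2.1 * c.2.2.1.b + c.2.1 ^ 2 * c.2.2.1.c +
      cv3 c.2.1 * c.2.2.1.d + cv4 c.2.1 * c.2.2.1.e := by
  decide +kernel

theorem certs_complete : ∀ p ∈ List.range 251, 7 ≤ p → (∀ d ∈ [2, 3, 5, 7, 11, 13], d ∣ p → p = d) →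
    ∀ r ∈ List.range p, (p : ℤ) ∣ (r : ℤ) ^ 5 - 5 * r ^ 4 - 20 * r ^ 3 - 20 * r ^ 2 - 20 * r - 20 →
      ∃ c ∈ certs, c.1 = p ∧ (p : ℤ) ∣ r - c.2.1 := by
  decide +kernel

theorem th_root : th ^ 5 - 5 * th ^ 4 - 20 * th ^ 3 - 20 * th ^ 2 - 20 * th - 20 = 0 := by decide

theorem principal_of_root {P : Ideal L5} [hPp : P.IsPrime] {p : ℕ} (hpp : p.Prime) (h7 : 7 ≤ p) (hp : p ≤ 250)
    (hP : HasChar P p) (r : ℤ) (hr : th - (r : L5) ∈ P) : ∃ γ, P = Ideal.span {γ} := by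
  have hp0 : (p : ℤ) ≠ 0 := by exact_mod_cast hpp.ne_zero
  -- replace `r` by its residue
  have hr0 : 0 ≤ r % p := Int.emod_nonneg _ hp0
  have hr1 : r % p < p := Int.emod_lt_of_pos _ (by exact_mod_cast hpp.pos)
  obtain ⟨s, hs⟩ := Int.eq_ofNat_of_zero_le hr0
  have hs' : th - ((s : ℤ) : L5) ∈ P := by
    have h1 : ((r - s : ℤ) : L5) ∈ P := by
      rw [hP, ← hs]; exact Int.dvd_self_sub_emod
    have := P.add_mem hr h1
    push_cast at this ⊢
    simpa using this
  have hg : (p : ℤ) ∣ (s : ℤ) ^ 5 - 5 * s ^ 4 - 20 * s ^ 3 - 20 * s ^ 2 - 20 * s - 20 := by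
    rw [← hP]
    have h1 : th - ((s : ℤ) : L5) ∣ (th ^ 5 - 5 * th ^ 4 - 20 * th ^ 3 - 20 * th ^ 2 - 20 * th - 20)
        - (((s : ℤ) : L5) ^ 5 - 5 * ((s : ℤ) : L5) ^ 4 - 20 * ((s : ℤ) : L5) ^ 3
          - 20 * ((s : ℤ) : L5) ^ 2 - 20 * ((s : ℤ) : L5) - 20) := by
      generalize ((s : ℤ) : L5) = t
      exact ⟨th ^ 4 + th ^ 3 * t + th ^ 2 * t ^ 2 + th * t ^ 3 + t ^ 4
        - 5 * (th ^ 3 + th ^ 2 * t + th * t ^ 2 + t ^ 3) - 20 * (th ^ 2 + th * t + t ^ 2)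
        - 20 * (th + t) - 20, by ring⟩
    rw [th_root, zero_sub, dvd_neg] at h1
    have h2 := P.mem_of_dvd h1 hs'
    push_cast at h2 ⊢
    exact h2
  obtain ⟨c, hc, hcp, hcr⟩ := certs_complete p (List.mem_range.2 (by omega)) h7 (by
    intro d hd hdp
    rcases (Nat.dvd_prime hpp).1 hdp with h | h
    · subst h; simp at hd
    · exact h.symm) s (List.mem_range.2 (by omega)) hg
  obtain ⟨hc1, ⟨k, hk⟩, hc3⟩ := certs_ok c hc
  obtain ⟨p', r', γ, a⟩ := c
  simp only at hcp hcr hc1 hk hc3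
  subst hcp
  refine ⟨γ, span_of_cert hpp.ne_zero hP hc1 ?_⟩
  have ht : th - (r' : L5) ∈ P := by
    have h1 : ((s - r' : ℤ) : L5) ∈ P := (hP _).2 hcr
    have := P.add_mem hs' h1
    push_cast at this ⊢
    simpa using this
  have h2 : (2 : L5) ∉ P := by
    intro h
    have := (hP 2).1 (by exact_mod_cast h)
    have := Int.le_of_dvd (by norm_num) this
    omega
  have hv3 : 2 * cv3 r' = r' ^ 2 + r' ^ 3 := by
    rw [cv3]; apply Int.mul_ediv_cancel'; rw [hk]; exact ⟨8 * k ^ 2 + 32 * k ^ 3, by ring⟩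
  have hv4 : 4 * cv4 r' = 2 * r' + r' ^ 3 + r' ^ 4 := by
    rw [cv4]; apply Int.mul_ediv_cancel'; rw [hk]
    exact ⟨2 * k + 16 * k ^ 3 + 64 * k ^ 4, by ring⟩
  have hv3' : (2 : L5) * (cv3 r' : L5) = (r' : L5) ^ 2 + (r' : L5) ^ 3 := by exact_mod_cast congrArg (Int.cast : ℤ → L5) hv3
  have hv4' : (2 : L5) * (2 * (cv4 r' : L5)) = 2 * (r' : L5) + (r' : L5) ^ 3 + (r' : L5) ^ 4 := by
    have := congrArg (Int.cast : ℤ → L5) hv4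
    push_cast at this
    rw [← this]; ring
  have e2 : (⟨0, 0, 1, 0, 0⟩ : L5) = th ^ 2 := by decide
  have e3 : (2 : L5) * ⟨0, 0, 0, 1, 0⟩ = th ^ 2 + th ^ 3 := by decide
  have e4 : (2 : L5) * (2 * ⟨0, 0, 0, 0, 1⟩) = 2 * th + th ^ 3 + th ^ 4 := by decide
  have m2 : (⟨0, 0, 1, 0, 0⟩ : L5) - (r' : L5) ^ 2 ∈ P := by
    rw [e2]
    exact P.mem_of_dvd ⟨th + r', by ring⟩ ht
  have m3 : (⟨0, 0, 0, 1, 0⟩ : L5) - (cv3 r' : L5) ∈ P := by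
    refine (hPp.mem_or_mem (x := 2) ?_).resolve_left h2
    rw [mul_sub, e3, hv3']
    exact P.mem_of_dvd ⟨th + r' + (th ^ 2 + th * r' + r' ^ 2), by ring⟩ ht
  have m4 : (⟨0, 0, 0, 0, 1⟩ : L5) - (cv4 r' : L5) ∈ P := by
    refine (hPp.mem_or_mem (x := 2) ?_).resolve_left h2
    refine (hPp.mem_or_mem (x := 2) ?_).resolve_left h2
    rw [mul_sub, mul_sub, e4, hv4']
    exact P.mem_of_dvd ⟨2 + (th ^ 2 + th * r' + r' ^ 2) + (th ^ 3 + th ^ 2 * r' + th * r' ^ 2 + r' ^ 3),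
      by ring⟩ ht
  have eγ : γ = ((γ.a + r' * γ.b + r' ^ 2 * γ.c + cv3 r' * γ.d + cv4 r' * γ.e : ℤ) : L5)
      + (γ.b : L5) * (th - (r' : L5)) + (γ.c : L5) * ((⟨0, 0, 1, 0, 0⟩ : L5) - (r' : L5) ^ 2)
      + (γ.d : L5) * ((⟨0, 0, 0, 1, 0⟩ : L5) - (cv3 r' : L5))
      + (γ.e : L5) * ((⟨0, 0, 0, 0, 1⟩ : L5) - (cv4 r' : L5)) := by
    have e0 : γ = (γ.a : L5) + γ.b * th + γ.c * ⟨0, 0, 1, 0, 0⟩ + γ.d * ⟨0, 0, 0, 1, 0⟩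
        + γ.e * ⟨0, 0, 0, 0, 1⟩ := by
      simp only [intCast_mul_eq, th]
      ext <;> simp
    conv_lhs => rw [e0]
    push_cast
    ring
  rw [eγ]
  exact P.add_mem (P.add_mem (P.add_mem (P.add_mem ((hP _).2 hc3) (P.mul_mem_left _ ht))
    (P.mul_mem_left _ m2)) (P.mul_mem_left _ m3)) (P.mul_mem_left _ m4)

theorem frob7 : Dvdc 7 ((th ^ 49 - th) * ⟨0, 0, 5, 0, 0⟩ - (th - 1)) := by decide +kernel
theorem frob11 : Dvdc 11 ((th ^ 121 - th) * ⟨3, 3, 0, 9, 0⟩ - 1) := by decide +kernel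
def g13 : L5 := ⟨5306, -5006, -7034, -6833, 2154⟩
def c13 : L5 := ⟨-36662, -12350, -14400, -54971, -57886⟩
theorem thirteen_eq : g13 * c13 = ((13 : ℤ) : L5) := by decide
theorem thirteen_eq' : ((13 : ℤ) : L5) = g13 * ⟨148, 31, 77, 95, -28⟩ * ⟨3, 2, 0, 0, 0⟩ * ⟨-3, -1, -1, -4, -4⟩ := by decide
theorem thirteen_two : Dvdc 13 (c13 * (⟨0, 0, 1, 0, 0⟩ - ⟨6, 3, 0, 0, 0⟩)) ∧
   Dvdc 13 (c13 * (⟨0, 0, 0, 1, 0⟩ - ⟨12, 9, 0, 0, 0⟩)) ∧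
   Dvdc 13 (c13 * (⟨0, 0, 0, 0, 1⟩ - ⟨1, 7, 0, 0, 0⟩)) := by decide

open L5

theorem int_mem_of_dvd (P : Ideal L5) {p : ℕ} (hP : HasChar P p) {x : L5} (h : Dvdc p x) : x ∈ P :=
  P.mem_of_dvd ((dvd_iff_dvdc p x).2 h) ((hP p).2 dvd_rfl)

theorem not_mem_of_mul_eq_one {P : Ideal L5} [hPp : P.IsPrime] {x y : L5} (h : x * y = 1) : x ∉ P := by
  intro hx
  exact hPp.ne_top ((Ideal.eq_top_iff_one _).2 (h ▸ P.mul_mem_right y hx))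

theorem principal_small {P : Ideal L5} [hPp : P.IsPrime] {p : ℕ} (hpp : p.Prime)
    (hP : HasChar P p) (h7 : p < 7) : ∃ γ, P = Ideal.span {γ} := by
  have hpm : ((p : ℤ) : L5) ∈ P := (hP p).2 dvd_rfl
  have hcases : p = 2 ∨ p = 3 ∨ p = 5 := by
    interval_cases p <;> revert hpp <;> decide
  rcases hcases with rfl | rfl | rfl
  · have h2 : (2 : L5) ∈ P := by exact_mod_cast hpm
    rw [two_eq] at h2
    have h3 := (hPp.mem_or_mem h2).resolve_right
      (not_mem_of_mul_eq_one (y := ⟨-334736, -112727, -131516, -501932, -528779⟩) (by decide))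
    rcases hPp.mem_or_mem h3 with h4 | h4
    · exact ⟨_, span_of_cert (by norm_num) hP certQ2 (hPp.mem_of_pow_mem _ h4)⟩
    · exact ⟨_, span_of_cert (by norm_num) hP certP2 h4⟩
  · have h2 : (3 : L5) ∈ P := by exact_mod_cast hpm
    rw [three_eq] at h2
    have h3 := (hPp.mem_or_mem h2).resolve_right
      (not_mem_of_mul_eq_one (y := ⟨852891, 1333492, 526446, 99340, -64336⟩) (by decide))
    rcases hPp.mem_or_mem h3 with h4 | h4
    · exact ⟨_, span_of_cert (by norm_num) hP certP3 (hPp.mem_of_pow_mem _ h4)⟩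
    · exact ⟨_, span_of_cert (by norm_num) hP certQ3 (hPp.mem_of_pow_mem _ h4)⟩
  · have h2 : (5 : L5) ∈ P := by exact_mod_cast hpm
    rw [five_eq] at h2
    have h3 := (hPp.mem_or_mem h2).resolve_right
      (not_mem_of_mul_eq_one (y := ⟨338704576, 114063258, 133075399, 507883654, 535048811⟩) (by decide))
    exact ⟨_, span_of_cert (by norm_num) hP certP5 (hPp.mem_of_pow_mem _ h3)⟩

theorem cert13 (γ a : L5) (r : ℤ) (h : (13, r, γ, a) ∈ certs) {P : Ideal L5} (hP : HasChar P 13)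
    (hγ : γ ∈ P) : ∃ γ, P = Ideal.span {γ} :=
  ⟨γ, span_of_cert (by norm_num) hP (certs_ok _ h).1 hγ⟩

theorem principal_thirteen {P : Ideal L5} [hPp : P.IsPrime] (hP : HasChar P 13) :
    ∃ γ, P = Ideal.span {γ} := by
  have hpm : ((13 : ℤ) : L5) ∈ P := (hP 13).2 dvd_rfl
  rw [thirteen_eq'] at hpm
  rcases hPp.mem_or_mem hpm with hpm | h
  swap
  · exact cert13 _ ⟨69, 69, 11, 138, -36⟩ 20 (by decide) hP h
  rcases hPp.mem_or_mem hpm with hpm | h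
  swap
  · exact cert13 _ ⟨-209, -106, -44, -240, 64⟩ 44 (by decide) hP h
  rcases hPp.mem_or_mem hpm with hpm | h
  swap
  · exact cert13 _ ⟨-14074, -10033, 597, 5085, -1232⟩ 16 (by decide) hP h
  by_cases hroot : ∃ r : ℤ, th - (r : L5) ∈ P
  · obtain ⟨r, hr⟩ := hroot
    exact principal_of_root (by norm_num) (by norm_num) (by norm_num) hP r hr
  refine ⟨g13, le_antisymm ?_ ((Ideal.span_singleton_le_iff_mem _).2 hpm)⟩
  intro x hx
  rw [Ideal.mem_span_singleton]
  obtain ⟨d2, d3, d4⟩ := thirteen_two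
  have h13 : (13 : ℤ) ≠ 0 := by norm_num
  have k2 := dvd_of_cofactor h13 thirteen_eq d2
  have k3 := dvd_of_cofactor h13 thirteen_eq d3
  have k4 := dvd_of_cofactor h13 thirteen_eq d4
  have hd : g13 ∣ x - (((x.a + 6 * x.c + 12 * x.d + x.e : ℤ) : L5)
      + ((x.b + 3 * x.c + 9 * x.d + 7 * x.e : ℤ) : L5) * th) := by
    have e : x - (((x.a + 6 * x.c + 12 * x.d + x.e : ℤ) : L5)
      + ((x.b + 3 * x.c + 9 * x.d + 7 * x.e : ℤ) : L5) * th)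
      = (x.c : L5) * (⟨0, 0, 1, 0, 0⟩ - ⟨6, 3, 0, 0, 0⟩)
        + (x.d : L5) * (⟨0, 0, 0, 1, 0⟩ - ⟨12, 9, 0, 0, 0⟩)
        + (x.e : L5) * (⟨0, 0, 0, 0, 1⟩ - ⟨1, 7, 0, 0, 0⟩) := by
      simp only [intCast_mul_eq, th]
      ext <;> simp only [sub_a, sub_b, sub_c, sub_d, sub_e, add_a, add_b, add_c, add_d, add_e,
        zcast_a, zcast_b, zcast_c, zcast_d, zcast_e] <;> ring
    rw [e]
    exact dvd_add (dvd_add (dvd_mul_of_dvd_right k2 _) (dvd_mul_of_dvd_right k3 _))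
      (dvd_mul_of_dvd_right k4 _)
  generalize x.a + 6 * x.c + 12 * x.d + x.e = s at hd
  generalize x.b + 3 * x.c + 9 * x.d + 7 * x.e = t at hd
  have hm : (s : L5) + (t : L5) * th ∈ P := by
    have := P.sub_mem hx (P.mem_of_dvd hd hpm)
    simpa using this
  have ht : (13 : ℤ) ∣ t := by
    by_contra hnt
    apply hroot
    have hco : IsCoprime t 13 := by
      rw [Int.isCoprime_iff_gcd_eq_one, Int.gcd_comm]
      exact (Int.isCoprime_iff_gcd_eq_one).1
        ((Prime.coprime_iff_not_dvd (by norm_num : Prime (13 : ℤ))).2 hnt)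
    obtain ⟨a, b, hab⟩ := hco
    refine ⟨-(a * s), ?_⟩
    have h1 := P.mul_mem_left (a : L5) hm
    have h2 : ((13 * b : ℤ) : L5) * th ∈ P := P.mul_mem_right _ ((hP _).2 ⟨b, rfl⟩)
    have h3 := P.add_mem h1 h2
    have h4 : (a : L5) * t + b * 13 = 1 := by exact_mod_cast congrArg (Int.cast : ℤ → L5) hab
    convert h3 using 1
    push_cast
    linear_combination (-th) * h4
  have hs : (13 : ℤ) ∣ s := by
    rw [← Nat.cast_ofNat, ← hP]
    have h1 : ((t : ℤ) : L5) * th ∈ P := P.mul_mem_right _ ((hP _).2 ht)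
    have := P.sub_mem hm h1
    simpa using this
  have hg : g13 ∣ ((13 : ℤ) : L5) := ⟨c13, thirteen_eq.symm⟩
  have h5 : g13 ∣ (s : L5) + (t : L5) * th := by
    obtain ⟨s', rfl⟩ := hs
    obtain ⟨t', rfl⟩ := ht
    rw [Int.cast_mul, Int.cast_mul]
    exact dvd_add (dvd_mul_of_dvd_left hg _) (dvd_mul_of_dvd_left (dvd_mul_of_dvd_left hg _) _)
  have := dvd_add hd h5
  simpa using this

theorem principal_of_norm_le (P : Ideal L5) (hPp : P.IsPrime) (h0 : 0 < Nat.card (L5 ⧸ P))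
    (h250 : Nat.card (L5 ⧸ P) ≤ 250) : ∃ γ, P = Ideal.span {γ} := by
  classical
  haveI : Finite (L5 ⧸ P) := Nat.finite_of_card_ne_zero h0.ne'
  haveI : Fintype (L5 ⧸ P) := Fintype.ofFinite _
  letI : Field (L5 ⧸ P) := Fintype.fieldOfDomain _
  obtain ⟨p, hchar⟩ := CharP.exists (L5 ⧸ P)
  obtain ⟨n, hpp, hcard⟩ := FiniteField.card (L5 ⧸ P) p
  rw [Nat.card_eq_fintype_card, hcard] at h250
  have hP : HasChar P p := by
    intro m
    rw [← Ideal.Quotient.eq_zero_iff_mem, map_intCast, CharP.intCast_eq_zero_iff (L5 ⧸ P) p]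
  have hfrob : ∀ x : L5, x ^ (p ^ (n : ℕ)) - x ∈ P := by
    intro x
    rw [← Ideal.Quotient.eq_zero_iff_mem, map_sub, map_pow, ← hcard, FiniteField.pow_card, sub_self]
  rcases lt_or_ge p 7 with h7 | h7
  · exact principal_small hpp hP h7
  have hn : (n : ℕ) ≤ 2 := by
    by_contra! h
    have : 7 ^ 3 ≤ p ^ (n : ℕ) :=
      (Nat.pow_le_pow_left h7 3).trans (Nat.pow_le_pow_right hpp.pos h)
    omega
  have hn1 := n.pos
  have hp250 : p ≤ 250 := le_trans (Nat.le_self_pow (by omega) p) h250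
  rcases (by omega : (n : ℕ) = 1 ∨ (n : ℕ) = 2) with h1 | h2
  · rw [h1, pow_one] at hcard
    have hsurj : Function.Surjective (ZMod.castHom (dvd_refl p) (L5 ⧸ P)) := by
      haveI : NeZero p := ⟨hpp.ne_zero⟩
      haveI := Fact.mk hpp
      refine ((Fintype.bijective_iff_injective_and_card _).2 ⟨RingHom.injective _, ?_⟩).2
      rw [ZMod.card, hcard]
    obtain ⟨z, hz⟩ := hsurj (Ideal.Quotient.mk P th)
    obtain ⟨r, rfl⟩ := ZMod.intCast_surjective z
    refine principal_of_root hpp h7 hp250 hP r ?_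
    rw [← Ideal.Quotient.eq_zero_iff_mem, map_sub, map_intCast, ← hz]
    simp
  · rw [h2] at h250 hfrob
    have hp15 : p < 16 := by nlinarith
    have hc : p = 7 ∨ p = 11 ∨ p = 13 := by
      interval_cases p <;> revert hpp <;> decide
    rcases hc with rfl | rfl | rfl
    · refine principal_of_root hpp h7 hp250 hP 1 ?_
      have h1 := P.mul_mem_right ⟨0, 0, 5, 0, 0⟩ (hfrob th)
      have h3 := P.sub_mem h1 (int_mem_of_dvd P hP frob7)
      have e : (7 : ℕ) ^ 2 = 49 := by norm_num
      rw [e, sub_sub_cancel] at h3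
      simpa using h3
    · exfalso
      have h1 := P.mul_mem_right ⟨3, 3, 0, 9, 0⟩ (hfrob th)
      have h3 := P.sub_mem h1 (int_mem_of_dvd P hP frob11)
      have e : (11 : ℕ) ^ 2 = 121 := by norm_num
      rw [e, sub_sub_cancel] at h3
      exact hPp.ne_top ((Ideal.eq_top_iff_one _).2 h3)
    · exact principal_thirteen hP

instance pid_L5 : IsPrincipalIdealRing L5 :=
  pid_of fun P hP h0 h250 => principal_of_norm_le P hP h0 h250

open L5

theorem rank_K5 : NumberField.Units.rank K5 = 2 := by
  rw [NumberField.Units.rank, NumberField.InfinitePlace.card_eq_nrRealPlaces_add_nrComplexPlaces,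
    nrReal_K5, nrComplex_K5]

/-- Squares in a commutative group. -/
abbrev Sq (G : Type*) [CommGroup G] : Subgroup G := (powMonoidHom 2 : G →* G).range

theorem zpow_mod_sq {G : Type*} [CommGroup G] (x : G) (n : ℤ) :
    (QuotientGroup.mk (x ^ n) : G ⧸ Sq G) = QuotientGroup.mk (x ^ (if n % 2 = 0 then 0 else 1 : ℕ)) := by
  rw [QuotientGroup.eq]
  have hn := Int.mul_ediv_add_emod n 2
  rcases Int.emod_two_eq_zero_or_one n with h | h
  · rw [if_pos h]
    refine ⟨x ^ (-(n / 2)), ?_⟩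
    rw [h] at hn
    rw [powMonoidHom_apply, pow_zero, mul_one, ← zpow_natCast, ← zpow_mul, ← zpow_neg]
    congr 1; push_cast; omega
  · rw [if_neg (by omega)]
    refine ⟨x ^ (-(n / 2)), ?_⟩
    rw [powMonoidHom_apply, ← zpow_natCast, ← zpow_mul, ← zpow_neg, ← zpow_natCast, ← zpow_add]
    congr 1; push_cast; omega

open NumberField in
theorem card_units_sq : Finite ((𝓞 K5)ˣ ⧸ Sq (𝓞 K5)ˣ) ∧ Nat.card ((𝓞 K5)ˣ ⧸ Sq (𝓞 K5)ˣ) ≤ 8 := by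
  let F : Bool × (Fin (Units.rank K5) → Bool) → (𝓞 K5)ˣ ⧸ Sq (𝓞 K5)ˣ := fun c =>
    QuotientGroup.mk ((if c.1 then 1 else -1) * ∏ i, (Units.fundSystem K5 i) ^ (if c.2 i then 0 else 1 : ℕ))
  have hF : Function.Surjective F := by
    intro q
    obtain ⟨x, rfl⟩ := QuotientGroup.mk_surjective q
    obtain ⟨⟨ζ, e⟩, hx, -⟩ := Units.exist_unique_eq_mul_prod K5 x
    simp only at hx
    have h1 := Units.torsion_eq_one_or_neg_one_of_odd_finrank
      (by rw [finrank_K5]; decide : Odd (Module.finrank ℚ K5)) ζ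
    classical
    refine ⟨(decide ((ζ : (𝓞 K5)ˣ) = 1), fun i => decide (e i % 2 = 0)), ?_⟩
    simp only [F]
    rw [hx, QuotientGroup.mk_mul, QuotientGroup.mk_mul, QuotientGroup.mk_prod, QuotientGroup.mk_prod]
    congr 1
    · rcases h1 with h | h
      · simp [h]
      · by_cases h' : (ζ : (𝓞 K5)ˣ) = 1
        · simp [h']
        · simp [h', h]
    · apply Finset.prod_congr rfl
      intro i _
      rw [zpow_mod_sq]
      simp
  refine ⟨Finite.of_surjective F hF, ?_⟩
  have := Nat.card_le_card_of_surjective F hF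
  have e : Nat.card (Bool × (Fin (Units.rank K5) → Bool)) = 8 := by
    rw [Nat.card_eq_fintype_card, Fintype.card_prod, Fintype.card_pi_const, rank_K5]
    rfl
  rwa [e] at this

def eps1 : L5 := ⟨336, 114, 131, 502, 521⟩
def eps2 : L5 := ⟨-756, -616, -28, 229, -52⟩

/-- The eight unit classes modulo squares. -/
def reps : List L5 := [1, -1, eps1, -eps1, eps2, -eps2, eps1 * eps2, -(eps1 * eps2)]
/-- Inverses of the eight unit classes. -/
def repsInv : List L5 :=
  let i1 : L5 := ⟨-579, -1206, -591, -239, 103⟩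
  let i2 : L5 := ⟨78884, 46044, 8286, 101987, -26604⟩
  [1, -1, i1, -i1, i2, -i2, i1 * i2, -(i1 * i2)]

/-- Reduction modulo a prime above 7. -/
def phi7 : L5 →+* ZMod 7 := mkHom 1 1 1 1 (by decide)

/-- Quadratic characters separating the unit classes. -/
def chi (x : L5) : ZMod 3 × ZMod 3 × ZMod 7 := (phiP3 x, phiQ3 x, phi7 x ^ 3)

theorem chi_mul_sq (x η : L5) (h : IsUnit η) : chi (x * η ^ 2) = chi x := by
  have k3 : ∀ t : ZMod 3, t ≠ 0 → t ^ 2 = 1 := by decide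
  have k7 : ∀ t : ZMod 7, t ≠ 0 → (t ^ 2) ^ 3 = 1 := by decide
  haveI : Fact (Nat.Prime 7) := ⟨by norm_num⟩
  simp only [chi, map_mul, map_pow]
  rw [k3 _ (h.map phiP3).ne_zero, k3 _ (h.map phiQ3).ne_zero, mul_pow, k7 _ (h.map phi7).ne_zero]
  simp

/-- The unit classes as units. -/
def repU (i : Fin 8) : L5ˣ where
  val := reps.get i
  inv := repsInv.get i
  val_inv := by revert i; decide
  inv_val := by revert i; decide

theorem chi_reps : ∀ i j : Fin 8, chi (reps.get i) = chi (reps.get j) → i = j := by decide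

theorem unit_decomp (x : L5) (hx : IsUnit x) : ∃ i : Fin 8, ∃ η : L5, x = reps.get i * η ^ 2 := by
  obtain ⟨hfin, hcard⟩ := card_units_sq
  let E : L5ˣ ≃* (NumberField.RingOfIntegers K5)ˣ := Units.mapEquiv e5.symm.toMulEquiv
  let F : Fin 8 → (NumberField.RingOfIntegers K5)ˣ ⧸ Sq (NumberField.RingOfIntegers K5)ˣ :=
    fun i => QuotientGroup.mk (E (repU i))
  have back : ∀ a b : L5ˣ, (QuotientGroup.mk (E a) : _ ⧸ Sq (NumberField.RingOfIntegers K5)ˣ)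
      = QuotientGroup.mk (E b) → ∃ η : L5ˣ, (b : L5) = a * η ^ 2 := by
    intro a b h
    rw [QuotientGroup.eq] at h
    obtain ⟨η, hη⟩ := h
    refine ⟨E.symm η, ?_⟩
    have h1 : b = a * (E.symm η) ^ 2 := by
      apply E.injective
      rw [map_mul, map_pow, MulEquiv.apply_symm_apply]
      rw [powMonoidHom_apply] at hη
      rw [hη, mul_inv_cancel_left]
    rw [h1]; push_cast; rfl
  have hinj : Function.Injective F := by
    intro i j h
    obtain ⟨η, hη⟩ := back _ _ h
    apply chi_reps
    have := chi_mul_sq (reps.get i) η η.isUnit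
    rw [← this]
    exact congrArg chi hη.symm
  have hsurj : Function.Surjective F := by
    haveI := Fintype.ofFinite ((NumberField.RingOfIntegers K5)ˣ ⧸ Sq (NumberField.RingOfIntegers K5)ˣ)
    refine ((Fintype.bijective_iff_injective_and_card F).2 ⟨hinj, le_antisymm ?_ ?_⟩).2
    · exact Fintype.card_le_of_injective F hinj
    · rw [Nat.card_eq_fintype_card] at hcard
      simpa using hcard
  obtain ⟨u, rfl⟩ := hx
  obtain ⟨i, hi⟩ := hsurj (QuotientGroup.mk (E u))
  obtain ⟨η, hη⟩ := back _ _ hi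
  exact ⟨i, η, hη⟩

open L5

section Forms

variable {S R T : Type*} [CommRing S] [CommRing R] [CommRing T]

/-- The value at `(u, v)` of the binary form of degree `n` with coefficient list `l`
(the entry with index `i` is the coefficient of `u ^ i * v ^ (n - i)`). -/
def hev (φ : S →+* R) : ℕ → List S → R → R → R
  | _, [], _, _ => 0
  | n, a :: l, u, v => φ a * v ^ n + u * hev φ (n - 1) l u v

/-- Coefficientwise addition with padding. -/
def ladd : List S → List S → List S
  | [], m => m
  | a :: l, [] => a :: l
  | a :: l, b :: m => (a + b) :: ladd l m

def lscale (c : S) (l : List S) : List S := l.map (c * ·)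

def lmul : List S → List S → List S
  | [], _ => []
  | a :: l, m => ladd (lscale a m) (0 :: lmul l m)

def lsub (l m : List S) : List S := ladd l (lscale (-1) m)

def dU : List S → List S
  | [] => []
  | [_] => []
  | _ :: b :: l => ladd (b :: l) (0 :: dU (b :: l))

def dV : ℕ → List S → List S
  | _, [] => []
  | 0, _ :: _ => []
  | n + 1, a :: l => (((n + 1 : ℕ) : S) * a) :: dV n l

def lin (α b : S) (m : List S) : List S := ladd (lscale α m) (0 :: lscale b m)

def lsubst (α b : S) : List S → List S
  | [] => []
  | a :: l => ladd [a] (lin α b (lsubst α b l))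

theorem hev_nil (φ : S →+* R) (n : ℕ) (u v : R) : hev φ n [] u v = 0 := rfl

theorem hev_cons (φ : S →+* R) (n : ℕ) (a : S) (l : List S) (u v : R) :
    hev φ n (a :: l) u v = φ a * v ^ n + u * hev φ (n - 1) l u v := rfl

theorem hev_ladd (φ : S →+* R) (u v : R) (l m : List S) : ∀ n : ℕ,
    hev φ n (ladd l m) u v = hev φ n l u v + hev φ n m u v := by
  induction l generalizing m with
  | nil => intro n; simp [ladd, hev]
  | cons a l ih =>
    intro n
    cases m with
    | nil => simp [ladd, hev]
    | cons b m =>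
      simp only [ladd, hev, ih, map_add]; ring

theorem hev_lscale (φ : S →+* R) (u v : R) (c : S) (l : List S) : ∀ n : ℕ,
    hev φ n (lscale c l) u v = φ c * hev φ n l u v := by
  induction l with
  | nil => intro n; simp [lscale, hev]
  | cons a l ih =>
    intro n
    have := ih (n - 1)
    simp only [lscale, List.map_cons, hev, map_mul] at this ⊢
    rw [this]; ring

theorem hev_lsub (φ : S →+* R) (u v : R) (l m : List S) (n : ℕ) :
    hev φ n (lsub l m) u v = hev φ n l u v - hev φ n m u v := by
  rw [lsub, hev_ladd, hev_lscale, map_neg, map_one]; ring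

theorem hev_add_deg (φ : S →+* R) (u v : R) (k : ℕ) (l : List S) : ∀ n : ℕ,
    l.length ≤ n + 1 → hev φ (n + k) l u v = v ^ k * hev φ n l u v := by
  induction l with
  | nil => intro n _; simp [hev]
  | cons a l ih =>
    intro n hn
    cases l with
    | nil => simp only [hev]; ring
    | cons b l =>
      simp only [List.length_cons] at hn ih
      obtain ⟨n, rfl⟩ : ∃ m, n = m + 1 := ⟨n - 1, by omega⟩
      rw [hev_cons φ (n + 1 + k), hev_cons φ (n + 1), show n + 1 + k - 1 = n + k by omega,
        ih n (by omega), Nat.add_sub_cancel]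
      ring

theorem hev_lmul (φ : S →+* R) (u v : R) (k : ℕ) (m : List S) (hm : m.length ≤ k + 1)
    (l : List S) : ∀ n : ℕ, l.length ≤ n + 1 →
    hev φ (n + k) (lmul l m) u v = hev φ n l u v * hev φ k m u v := by
  induction l with
  | nil => intro n _; simp [lmul, hev]
  | cons a l ih =>
    intro n hn
    rw [lmul, hev_ladd, hev_lscale, hev_cons, hev_cons, map_zero, zero_mul, zero_add,
      Nat.add_comm n k, hev_add_deg φ u v n m k hm]
    cases l with
    | nil => simp only [lmul, hev]; ring
    | cons b l =>
      simp only [List.length_cons] at hn ih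
      obtain ⟨n, rfl⟩ : ∃ m, n = m + 1 := ⟨n - 1, by omega⟩
      rw [show k + (n + 1) - 1 = n + k by omega, ih n (by omega), Nat.add_sub_cancel]
      ring

theorem hev_map (φ : S →+* R) (ψ : R →+* T) (l : List S) (u v : R) : ∀ n : ℕ,
    ψ (hev φ n l u v) = hev (ψ.comp φ) n l (ψ u) (ψ v) := by
  induction l with
  | nil => intro n; simp [hev]
  | cons a l ih => intro n; simp [hev, ih]

theorem hev_comp (φ : S →+* R) (ψ : R →+* T) (l : List S) (u v : T) : ∀ n : ℕ,
    hev (ψ.comp φ) n l u v = hev ψ n (l.map φ) u v := by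
  induction l with
  | nil => intro n; simp [hev]
  | cons a l ih => intro n; simp [hev, ih]

theorem hev_smul (φ : S →+* R) (u v d : R) (l : List S) : ∀ n : ℕ, l.length ≤ n + 1 →
    hev φ n l (d * u) (d * v) = d ^ n * hev φ n l u v := by
  induction l with
  | nil => intro n _; simp [hev]
  | cons a l ih =>
    intro n hn
    cases l with
    | nil => simp only [hev]; ring
    | cons b l =>
      simp only [List.length_cons] at hn ih
      obtain ⟨n, rfl⟩ : ∃ m, n = m + 1 := ⟨n - 1, by omega⟩
      rw [hev_cons φ (n + 1), hev_cons φ (n + 1), Nat.add_sub_cancel, ih n (by omega)]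
      ring

theorem hev_lsubst (φ : S →+* R) (α b : S) (t v : R) (l : List S) : ∀ n : ℕ, l.length ≤ n + 1 →
    hev φ n l (φ α * v + φ b * t) v = hev φ n (lsubst α b l) t v ∧
      (lsubst α b l).length ≤ l.length := by
  have hlen : ∀ x y : List S, ∀ N, x.length ≤ N → y.length ≤ N → (ladd x y).length ≤ N := by
    intro x
    induction x with
    | nil => intro y N _ h; simpa [ladd] using h
    | cons a x ih =>
      intro y N h1 h2
      cases y with
      | nil => simpa [ladd] using h1
      | cons b y =>
        simp only [List.length_cons, ladd] at *
        have := ih y (N - 1) (by omega) (by omega)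
        omega
  induction l with
  | nil => intro n _; simp [hev, lsubst]
  | cons a l ih =>
    intro n hn
    have hl : (lsubst α b l).length ≤ l.length := by
      have := ih l.length (by omega); exact this.2
    constructor
    · rw [lsubst, hev_ladd, lin, hev_ladd, hev_lscale, hev_cons, hev_cons, hev_nil, hev_cons,
        hev_lscale, map_zero]
      cases l with
      | nil => simp only [hev, lsubst]; ring
      | cons c l =>
        simp only [List.length_cons] at hn ih hl
        obtain ⟨n, rfl⟩ : ∃ m, n = m + 1 := ⟨n - 1, by omega⟩
        rw [Nat.add_sub_cancel, (ih n (by omega)).1,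
          hev_add_deg φ t v 1 (lsubst α b (c :: l)) n (by omega)]
        ring
    · rw [lsubst, lin]
      refine hlen _ _ _ (by simp) (hlen _ _ _ ?_ ?_)
      · simp [lscale]; omega
      · simp [lscale]; omega

theorem hev_append (φ : S →+* R) (u v : R) (b : S) (l : List S) : ∀ n : ℕ, l.length ≤ n →
    hev φ n (l ++ [b]) u v = hev φ n l u v + φ b * u ^ l.length * v ^ (n - l.length) := by
  induction l with
  | nil => intro n _; simp [hev]
  | cons a l ih =>
    intro n hn
    simp only [List.length_cons] at hn
    obtain ⟨n, rfl⟩ : ∃ m, n = m + 1 := ⟨n - 1, by omega⟩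
    rw [List.cons_append, hev_cons, hev_cons, Nat.add_sub_cancel, ih n (by omega),
      List.length_cons, show n + 1 - (l.length + 1) = n - l.length by omega]
    ring

theorem hev_reverse (φ : S →+* R) (u v : R) (l : List S) : ∀ n : ℕ, l.length = n + 1 →
    hev φ n l u v = hev φ n l.reverse v u := by
  induction l with
  | nil => intro n h; simp at h
  | cons a l ih =>
    intro n hn
    simp only [List.length_cons, Nat.add_right_cancel_iff] at hn
    subst hn
    rw [List.reverse_cons, hev_append φ v u a l.reverse _ (by simp), hev_cons]
    cases l with
    | nil => simp [hev]
    | cons b l =>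
      rw [List.length_cons, Nat.add_sub_cancel, ih l.length (by simp)]
      rw [hev_add_deg φ v u 1 _ l.length (by simp)]
      simp; ring

end Forms

section Poly
open MvPolynomial

theorem pderiv_zero_hev (l : List ℤ) : ∀ n : ℕ,
    pderiv 0 (hev (Int.castRingHom (MvPolynomial (Fin 2) ℚ)) n l (X 0) (X 1))
      = hev (Int.castRingHom _) (n - 1) (dU l) (X 0) (X 1) := by
  have h01 : pderiv (0 : Fin 2) (X 1 : MvPolynomial (Fin 2) ℚ) = 0 :=
    pderiv_X_of_ne (by decide)
  induction l with
  | nil => intro n; simp [hev, dU]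
  | cons a l ih =>
    intro n
    cases l with
    | nil =>
      rw [dU, hev_cons, hev_nil, mul_zero, add_zero, pderiv_mul, pderiv_pow, h01]
      simp
    | cons b l =>
      rw [dU, hev_cons, hev_ladd, hev_cons _ _ 0, map_add, pderiv_mul, pderiv_mul, ih, pderiv_pow,
        h01, pderiv_X_self]
      simp

theorem pderiv_one_hev (l : List ℤ) : ∀ n : ℕ,
    pderiv 1 (hev (Int.castRingHom (MvPolynomial (Fin 2) ℚ)) n l (X 0) (X 1))
      = hev (Int.castRingHom _) (n - 1) (dV n l) (X 0) (X 1) := by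
  have h10 : pderiv (1 : Fin 2) (X 0 : MvPolynomial (Fin 2) ℚ) = 0 :=
    pderiv_X_of_ne (by decide)
  induction l with
  | nil => intro n; simp [hev, dV]
  | cons a l ih =>
    intro n
    cases n with
    | zero =>
      have h0 : dV 0 l = [] := by cases l <;> rfl
      rw [dV, hev_cons, hev_nil, map_add, pderiv_mul, pderiv_mul, ih, h10, h0]
      simp [hev_nil]
    | succ n =>
      rw [dV, hev_cons, hev_cons, map_add, pderiv_mul, pderiv_mul, Nat.add_sub_cancel, ih,
        pderiv_pow, h10, pderiv_X_self]
      simp; ring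

theorem hev_homog (l : List ℤ) : ∀ n : ℕ, l.length ≤ n + 1 →
    (hev (Int.castRingHom (MvPolynomial (Fin 2) ℚ)) n l (X 0) (X 1)).IsHomogeneous n := by
  have hc : ∀ a : ℤ, (Int.castRingHom (MvPolynomial (Fin 2) ℚ) a).IsHomogeneous 0 := by
    intro a
    have := isHomogeneous_C (Fin 2) (a : ℚ)
    simpa using this
  induction l with
  | nil => intro n _; exact isHomogeneous_zero _ _ _
  | cons a l ih =>
    intro n hn
    rw [hev_cons]
    have h1 : (Int.castRingHom (MvPolynomial (Fin 2) ℚ) a * X 1 ^ n).IsHomogeneous n := by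
      have := (hc a).mul ((isHomogeneous_X ℚ (1 : Fin 2)).pow n)
      simpa using this
    refine h1.add ?_
    cases l with
    | nil => rw [hev_nil, mul_zero]; exact isHomogeneous_zero _ _ _
    | cons b l =>
      simp only [List.length_cons] at hn ih
      obtain ⟨n, rfl⟩ : ∃ m, n = m + 1 := ⟨n - 1, by omega⟩
      have := (isHomogeneous_X ℚ (0 : Fin 2)).mul (ih n (by omega))
      rw [Nat.add_sub_cancel, add_comm n 1]
      exact this

theorem hev_int_coeff (l : List ℤ) (n : ℕ) (m : Fin 2 →₀ ℕ) :
    ∃ z : ℤ, coeff m (hev (Int.castRingHom (MvPolynomial (Fin 2) ℚ)) n l (X 0) (X 1)) = z := by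
  have h := hev_map (Int.castRingHom (MvPolynomial (Fin 2) ℤ))
    (MvPolynomial.map (Int.castRingHom ℚ)) l (X 0) (X 1) n
  rw [map_X, map_X, RingHom.ext_int ((MvPolynomial.map (Int.castRingHom ℚ)).comp
    (Int.castRingHom (MvPolynomial (Fin 2) ℤ))) (Int.castRingHom _)] at h
  rw [← h, coeff_map]
  exact ⟨_, rfl⟩

theorem eval_hev (l : List ℤ) (n : ℕ) (u v : ℤ) :
    eval ![(u : ℚ), (v : ℚ)] (hev (Int.castRingHom (MvPolynomial (Fin 2) ℚ)) n l (X 0) (X 1))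
      = ((hev (RingHom.id ℤ) n l u v : ℤ) : ℚ) := by
  rw [hev_map, show ((hev (RingHom.id ℤ) n l u v : ℤ) : ℚ)
    = Int.castRingHom ℚ (hev (RingHom.id ℤ) n l u v) from rfl, hev_map]
  rw [RingHom.ext_int ((eval ![(u : ℚ), (v : ℚ)]).comp (Int.castRingHom _)) 
    ((Int.castRingHom ℚ).comp (RingHom.id ℤ))]
  simp

end Poly

open L5

/-- Coefficients of `h`. -/
def lH : List ℤ :=
  [55, 348, -462, -660, -4455, -11880, -10692, 7128, -4455, -5940, -8910, -5508, 567]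

/-- Coefficients of `g`. -/
def lG : List ℤ :=
  [-1226, 380, -25840, -160740, -490770, -347472, 328320, -2831760, -4935060, -6135480, 1493856,
   10937160, 13204620, 24747120, 20684160, 3767472, -5401890, 277020, -1108080, -772740,
   -287226]

/-- Coefficients of `f`. -/
def lA : List ℤ :=
  [-36599, 240930, 1657785, 11693960, 34087905, 49546674, 254142225, 1307923200, 2375837325,
   1812605850, -2443371075, -1782891000, 5260879125, 2309654250, 19632061125, 50258076480,
   106013130075, 156594558150, 139272151275, 28882834200, -78311866365, -84387472650,
   -64658162925, -72150004800, -27156143025, 1161021438, 2936802015, -2717041320, -1104511545,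
   -631233810, -153743913]

/-- Coefficients of the sextic factor of `-f` over the quintic field. -/
def lF : List L5 :=
  [⟨-341, -1001, -574, -305, 117⟩, ⟨176, -494, -488, -408, 134⟩, ⟨4875, 3725, -20, -1645, 385⟩,
   ⟨-1280, -6380, -4180, -2600, 940⟩, ⟨765, -9435, -7770, -5895, 1995⟩,
   ⟨-48, -1278, -972, -720, 246⟩, ⟨2733, 4623, 1956, 501, -273⟩]

/-- Coefficients of the complementary factor of `-f`. -/
def lF2 : List L5 :=
  [⟨87256, 51737, 8302, 114368, -29129⟩, ⟨-1110434, -612620, -156260, -1372290, 363576⟩,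
   ⟨81296, -435278, 543106, -729096, 172388⟩, ⟨4449726, 1001172, 2232956, 2997398, -862436⟩,
   ⟨-40635324, -21919548, -6264918, -49347852, 13055610⟩,
   ⟨-95699838, -57512316, -8113716, -126500334, 33293472⟩,
   ⟨31551072, -36314490, 64218270, -54201960, 11775012⟩,
   ⟨-690182478, -465905196, -2502468, -1001723382, 258063516⟩,
   ⟨-1585980108, -874826811, -223709148, -1961230644, 514616733⟩,
   ⟨-3679511508, -1900325016, -661722696, -4326858324, 1142231760⟩,
   ⟨-7875938016, -4050826092, -1432465452, -9229714128, 2452805064⟩,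
   ⟨-10397173716, -5049584280, -2221550280, -11664370980, 3120610104⟩,
   ⟨-16737650136, -7995331152, -3724014636, -18545688504, 4959959292⟩,
   ⟨-17218914876, -7817095512, -4285157256, -18356701788, 4963869216⟩,
   ⟨-17387078976, -7871376852, -4353793092, -18477555408, 5049556200⟩,
   ⟨-3969292572, -1841138424, -943548264, -4271427756, 1232477208⟩,
   ⟨7719141888, 3074801715, 2400268950, 7498989720, -2002142367⟩,
   ⟨19584513558, 8905000356, 4860164268, 20925010422, -5597512776⟩,
   ⟨17962991568, 9179272026, 3335176458, 20955933144, -5524545708⟩,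
   ⟨6967448118, 3583533636, 1267675596, 8163375534, -2157737940⟩,
   ⟨-1586592684, -892450548, -204223518, -1994797692, 520909866⟩,
   ⟨-1334424294, -728402220, -197427780, -1636276950, 430448256⟩,
   ⟨437330016, 254623662, 46228806, 565278264, -145645452⟩,
   ⟨558817866, 273453732, 117021996, 630848898, -168022836⟩,
   ⟨106436916, 48247407, 26541432, 113557788, -30300885⟩]

/-- The sextic factor after the substitution `u = v + 8 t`, without its content. -/
def lGp : List L5 :=
  [⟨43662047500, 29720002937, -112011201, 63832918906, -16352084063⟩,
   ⟨1009659461668, 790522298722, -117156879489, 1656142552178, -417802899700⟩,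
   ⟨15414216669840, 11754301345160, -1439790035300, 24735743430920, -6257709270320⟩,
   ⟨141257837444480, 100613526774080, -5312470393760, 214294881189440, -54617196926080⟩,
   ⟨605899512583680, 431609881447680, -22838635850880, 919259837533440, -234288347205120⟩,
   ⟨689239108116480, 659269384814592, -212692377010176, 1339122691547136, -331165985046528⟩,
   ⟨-978357709258752, -134662039707648, -586928244240384, -504025028861952, 162307514941440⟩]

/-- The sextic factor after the substitution `u = -v + 8 t`, without its content. -/
def lGm : List L5 :=
  [⟨2335055776, 3928772743, -2601368880, 7492478048, -1773202421⟩,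
   ⟨1113942144196, 468180866874, 318949372627, 1122832936666, -305757228660⟩,
   ⟨-28336101864720, -12753333458920, -7177068587180, -30033615475240, 8101949339440⟩,
   ⟨271869551576960, 123128898244160, 68008506150880, 289494547392320, -78028688794240⟩,
   ⟨-1172859724992000, -518722511796480, -307218393563520, -1227166991458560, 331832429360640⟩,
   ⟨2156775672004608, 861262444376064, 667699989350400, 2095160234840064, -574627257458688⟩,
   ⟨-978357709258752, -134662039707648, -586928244240384, -504025028861952, 162307514941440⟩]

/-- Cofactor of `h` in the resultant identity. -/
def bzV1 : List ℤ :=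
  [27936434024, -86220961534, -785926510506, -3315202449574, -3222169301940, 5161137432528,
   -17733320375568, -32223903211872, -48715211140668, 714860066196, 73856861576820,
   79334213513940, 172026665020980, 156992164670880, 35315122596336, -42648007946544,
   3261681386964, -7874072179974, -5734556373546, -2245765808286]

/-- Cofactor of `g` in the resultant identity. -/
def bzV2 : List ℤ :=
  [-3365258180, 3018701507, 1605132735, 23732284455, 80359396260, 91551691638, -60066111798,
   29442763350, 37639962360, 63698449815, 43672740111, -4433265837]

/-- Cofactor of `h` in the resultant identity. -/
def bzU1 : List ℤ :=
  [44915244374, -4065675614, 938932088094, 6101519133996, 19170649951024, 16137368210832,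
   -10676447302752, 101003087323292, 205250854390428, 252387079886172, -15654500989476,
   -425411115849684, -553266921665376, -982774540752624, -933967478429136, -235515530925468,
   190675669355838, 16306709555682, 24349058417718, 57896005194792]

/-- Cofactor of `g` in the resultant identity. -/
def bzU2 : List ℤ :=
  [2014957945, 13191335157, -14337878555, -29062507760, -165820050110, -470273200210,
   -471446632734, 208207931580, -93656816715, -298355565915, -325730224215, -273736432836]

theorem chk_g : lsub (lmul (dU (dU lH)) (dV 11 (dV 12 lH))) (lmul (dV 11 (dU lH)) (dV 11 (dU lH)))
    = lscale 17424 lG := by decide +kernel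

theorem chk_f : lsub (lmul (dU lH) (dV 20 lG)) (lmul (dV 12 lH) (dU lG))
    = lscale 240 lA := by decide +kernel

section Poly
open MvPolynomial

theorem hC40_eq : hC40 = hev (Int.castRingHom (MvPolynomial (Fin 2) ℚ)) 12 lH (X 0) (X 1) := by
  have e : ∀ z : ℤ, (z : MvPolynomial (Fin 2) ℚ) = C (z : ℚ) := fun z => by simp
  simp only [hC40, lH, hev, Fin.sum_univ_succ, alphaC40, eq_intCast, e]
  have key : (C (81 / 7 : ℚ) : MvPolynomial (Fin 2) ℚ) * 7 = 81 := by
    rw [show (7 : MvPolynomial (Fin 2) ℚ) = C (7 : ℚ) from (map_ofNat C 7).symm, ← C_mul]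
    norm_num [map_ofNat]
  simp [Nat.choose]
  norm_num
  simp only [map_ofNat]
  linear_combination (-132 * X 0 ^ 6 * X 1 ^ 6) * key

theorem gC40_eq : gC40 = hev (Int.castRingHom (MvPolynomial (Fin 2) ℚ)) 20 lG (X 0) (X 1) := by
  have h := congrArg (fun l => hev (Int.castRingHom (MvPolynomial (Fin 2) ℚ)) (10 + 10) l
    (X 0) (X 1)) chk_g
  rw [hev_lsub, hev_lmul _ _ _ 10 _ (by decide) _ 10 (by decide),
    hev_lmul _ _ _ 10 _ (by decide) _ 10 (by decide), hev_lscale] at h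
  rw [gC40, hC40_eq]
  simp only [pderiv_zero_hev, pderiv_one_hev]
  rw [h, eq_intCast, show ((17424 : ℤ) : MvPolynomial (Fin 2) ℚ) = C (17424 : ℚ) from (map_ofNat C 17424).symm,
    ← mul_assoc, ← C_mul]
  norm_num

theorem fC40_eq : fC40 = hev (Int.castRingHom (MvPolynomial (Fin 2) ℚ)) 30 lA (X 0) (X 1) := by
  have h := congrArg (fun l => hev (Int.castRingHom (MvPolynomial (Fin 2) ℚ)) (11 + 19) l
    (X 0) (X 1)) chk_f
  rw [hev_lsub, hev_lmul _ _ _ 19 _ (by decide) _ 11 (by decide),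
    hev_lmul _ _ _ 19 _ (by decide) _ 11 (by decide), hev_lscale] at h
  rw [fC40, hC40_eq, gC40_eq]
  simp only [pderiv_zero_hev, pderiv_one_hev]
  rw [h, eq_intCast, show ((240 : ℤ) : MvPolynomial (Fin 2) ℚ) = C (240 : ℚ) from (map_ofNat C 240).symm,
    ← mul_assoc, ← C_mul]
  norm_num

end Poly
open L5

theorem chk_prod : lmul lF lF2 = (lscale (-1) lA).map (Int.castRingHom L5) := by decide +kernel
theorem chk_dU : ladd (lmul (dU lF) lF2) (lmul lF (dU lF2))
    = (lscale (-1) (dU lA)).map (Int.castRingHom L5) := by decide +kernel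
theorem chk_dV : ladd (lmul (dV 6 lF) lF2) (lmul lF (dV 24 lF2))
    = (lscale (-1) (dV 30 lA)).map (Int.castRingHom L5) := by decide +kernel
theorem chk_j1 : lsub (lmul (dU lA) (dV 12 lH)) (lmul (dV 30 lA) (dU lH))
    = lscale 360 (lmul lG lG) := by decide +kernel
theorem chk_j2 : lsub (lmul (dU lA) (dV 20 lG)) (lmul (dV 30 lA) (dU lG))
    = lscale (-600) (lmul (lmul lH lH) (lmul lH lH)) := by decide +kernel
theorem chk_bzV : ladd (lmul bzV1 lH) (lmul bzV2 lG)
    = (2 ^ 26 * 3 ^ 3 * 5 ^ 5) :: List.replicate 31 0 := by decide +kernel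
theorem chk_bzU : ladd (lmul bzU1 lH) (lmul bzU2 lG)
    = List.replicate 31 0 ++ [2 ^ 26 * 3 ^ 12 * 5 ^ 5] := by decide +kernel

theorem hev_castList {R : Type*} [CommRing R] (l : List ℤ) (n : ℕ) (U V : R) :
    hev (RingHom.id R) n (l.map (Int.castRingHom R)) U V = hev (Int.castRingHom R) n l U V := by
  rw [← hev_comp, RingHom.id_comp]

theorem hev_cast {R : Type*} [CommRing R] (l : List ℤ) (n : ℕ) (u v : ℤ) :
    hev (Int.castRingHom R) n l (u : R) (v : R) = ((hev (RingHom.id ℤ) n l u v : ℤ) : R) := by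
  have := hev_map (RingHom.id ℤ) (Int.castRingHom R) l u v n
  rw [RingHom.comp_id] at this
  exact this.symm

theorem hev_replicate {S R : Type*} [CommRing S] [CommRing R] (φ : S →+* R) (u v : R) (k : ℕ) :
    ∀ n, hev φ n (List.replicate k 0) u v = 0 := by
  induction k with
  | zero => intro n; rfl
  | succ k ih => intro n; rw [List.replicate_succ, hev_cons, ih]; simp

theorem prod_eq (u v : ℤ) : hev (RingHom.id L5) 6 lF u v * hev (RingHom.id L5) 24 lF2 u v
    = ((-hev (RingHom.id ℤ) 30 lA u v : ℤ) : L5) := by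
  have h := congrArg (fun l => hev (RingHom.id L5) (6 + 24) l (u : L5) (v : L5)) chk_prod
  rw [hev_lmul _ _ _ 24 _ (by decide) _ 6 (by decide), hev_castList, hev_lscale, hev_cast] at h
  rw [h]; simp

theorem castR_eq (a b c : ℕ) : Int.castRingHom L5 (2 ^ a * 3 ^ b * 5 ^ c)
    = 2 ^ a * 3 ^ b * 5 ^ c := by simp

set_option maxHeartbeats 1000000 in
/-- A prime dividing both factors divides the resultants. -/
theorem common_prime {q : L5} (hq : Prime q) (u v : ℤ) (huv : IsCoprime u v)
    (h0 : q ∣ hev (RingHom.id L5) 6 lF u v) (h2 : q ∣ hev (RingHom.id L5) 24 lF2 u v)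
    (q2 : ¬ q ∣ 2) (q3 : ¬ q ∣ 3) (q5 : ¬ q ∣ 5) : False := by
  have pow_not : ∀ (x : L5) (n : ℕ), ¬ q ∣ x → ¬ q ∣ x ^ n :=
    fun x n hx h => hx (hq.dvd_of_dvd_pow h)
  have mul_not : ∀ x y : L5, ¬ q ∣ x → ¬ q ∣ y → ¬ q ∣ x * y :=
    fun x y hx hy h => (hq.dvd_or_dvd h).elim hx hy
  have canc : ∀ x y : L5, ¬ q ∣ x → q ∣ x * y → q ∣ y :=
    fun x y hx h => (hq.dvd_or_dvd h).resolve_left hx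
  have hfu : q ∣ hev (Int.castRingHom L5) 29 (dU lA) u v := by
    have h := congrArg (fun l => hev (RingHom.id L5) 29 l (u : L5) (v : L5)) chk_dU
    rw [hev_ladd, hev_lmul _ _ _ 24 _ (by decide) _ 5 (by decide),
      hev_lmul _ _ _ 23 _ (by decide) _ 6 (by decide), hev_castList, hev_lscale] at h
    have h' : q ∣ Int.castRingHom L5 (-1) * hev (Int.castRingHom L5) 29 (dU lA) u v := by
      rw [← h]
      exact dvd_add (dvd_mul_of_dvd_right h2 _) (dvd_mul_of_dvd_left h0 _)
    simpa using h'
  have hfv : q ∣ hev (Int.castRingHom L5) 29 (dV 30 lA) u v := by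
    have h := congrArg (fun l => hev (RingHom.id L5) 29 l (u : L5) (v : L5)) chk_dV
    rw [hev_ladd, hev_lmul _ _ _ 24 _ (by decide) _ 5 (by decide),
      hev_lmul _ _ _ 23 _ (by decide) _ 6 (by decide), hev_castList, hev_lscale] at h
    have h' : q ∣ Int.castRingHom L5 (-1) * hev (Int.castRingHom L5) 29 (dV 30 lA) u v := by
      rw [← h]
      exact dvd_add (dvd_mul_of_dvd_right h2 _) (dvd_mul_of_dvd_left h0 _)
    simpa using h'
  have hg : q ∣ hev (Int.castRingHom L5) 20 lG u v := by
    have h := congrArg (fun l => hev (Int.castRingHom L5) 40 l (u : L5) (v : L5)) chk_j1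
    rw [hev_lsub, hev_lmul _ _ _ 11 _ (by decide) _ 29 (by decide),
      hev_lmul _ _ _ 11 _ (by decide) _ 29 (by decide), hev_lscale,
      hev_lmul _ _ _ 20 _ (by decide) _ 20 (by decide)] at h
    have h' := dvd_sub (dvd_mul_of_dvd_left hfu (hev (Int.castRingHom L5) 11 (dV 12 lH) u v))
      (dvd_mul_of_dvd_left hfv (hev (Int.castRingHom L5) 11 (dU lH) u v))
    rw [h] at h'
    have h3 := canc _ _ (by
      rw [show Int.castRingHom L5 360 = 2 ^ 3 * 3 ^ 2 * 5 by decide]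
      exact mul_not _ _ (mul_not _ _ (pow_not _ _ q2) (pow_not _ _ q3)) q5) h'
    exact (hq.dvd_or_dvd h3).elim id id
  have hh : q ∣ hev (Int.castRingHom L5) 12 lH u v := by
    have h := congrArg (fun l => hev (Int.castRingHom L5) 48 l (u : L5) (v : L5)) chk_j2
    rw [hev_lsub, hev_lmul _ _ _ 19 _ (by decide) _ 29 (by decide),
      hev_lmul _ _ _ 19 _ (by decide) _ 29 (by decide), hev_lscale,
      hev_lmul _ _ _ 24 _ (by decide) _ 24 (by decide),
      hev_lmul _ _ _ 12 _ (by decide) _ 12 (by decide)] at h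
    have h' := dvd_sub (dvd_mul_of_dvd_left hfu (hev (Int.castRingHom L5) 19 (dV 20 lG) u v))
      (dvd_mul_of_dvd_left hfv (hev (Int.castRingHom L5) 19 (dU lG) u v))
    rw [h] at h'
    have h3 := canc _ _ (by
      rw [show Int.castRingHom L5 (-600) = 2 ^ 3 * 3 * (5 ^ 2 * (-1)) by decide]
      refine mul_not _ _ (mul_not _ _ (pow_not _ _ q2) q3) (mul_not _ _ (pow_not _ _ q5) ?_)
      intro h
      exact hq.not_isUnit (isUnit_of_dvd_unit h (by simp))) h'
    have h4 := (hq.dvd_or_dvd h3).elim id id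
    exact (hq.dvd_or_dvd h4).elim id id
  have hv : q ∣ (v : L5) := by
    have h := congrArg (fun l => hev (Int.castRingHom L5) 31 l (u : L5) (v : L5)) chk_bzV
    rw [hev_ladd, hev_lmul _ _ _ 12 _ (by decide) _ 19 (by decide),
      hev_lmul _ _ _ 20 _ (by decide) _ 11 (by decide), hev_cons, hev_replicate] at h
    have h' := dvd_add (dvd_mul_of_dvd_right hh (hev (Int.castRingHom L5) 19 bzV1 u v))
      (dvd_mul_of_dvd_right hg (hev (Int.castRingHom L5) 11 bzV2 u v))
    rw [h, mul_zero, add_zero, castR_eq] at h'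
    rcases hq.dvd_or_dvd h' with h3 | h3
    · rcases hq.dvd_or_dvd h3 with h4 | h4
      · rcases hq.dvd_or_dvd h4 with h5 | h5
        · exact absurd (hq.dvd_of_dvd_pow h5) q2
        · exact absurd (hq.dvd_of_dvd_pow h5) q3
      · exact absurd (hq.dvd_of_dvd_pow h4) q5
    · exact hq.dvd_of_dvd_pow h3
  have hu : q ∣ (u : L5) := by
    have h := congrArg (fun l => hev (Int.castRingHom L5) 31 l (u : L5) (v : L5)) chk_bzU
    rw [hev_ladd, hev_lmul _ _ _ 12 _ (by decide) _ 19 (by decide),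
      hev_lmul _ _ _ 20 _ (by decide) _ 11 (by decide),
      hev_append _ _ _ _ _ _ (by decide), hev_replicate] at h
    have h' := dvd_add (dvd_mul_of_dvd_right hh (hev (Int.castRingHom L5) 19 bzU1 u v))
      (dvd_mul_of_dvd_right hg (hev (Int.castRingHom L5) 11 bzU2 u v))
    rw [h, zero_add, castR_eq, List.length_replicate, Nat.sub_self, pow_zero, mul_one] at h'
    rcases hq.dvd_or_dvd h' with h3 | h3
    · rcases hq.dvd_or_dvd h3 with h4 | h4
      · rcases hq.dvd_or_dvd h4 with h5 | h5
        · exact absurd (hq.dvd_of_dvd_pow h5) q2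
        · exact absurd (hq.dvd_of_dvd_pow h5) q3
      · exact absurd (hq.dvd_of_dvd_pow h4) q5
    · exact hq.dvd_of_dvd_pow h3
  obtain ⟨a, b, hab⟩ := huv
  refine hq.not_dvd_one ?_
  have h1 : (a : L5) * u + b * v = 1 := by exact_mod_cast congrArg (Int.cast : ℤ → L5) hab
  rw [← h1]
  exact dvd_add (dvd_mul_of_dvd_right hu _) (dvd_mul_of_dvd_right hv _)

open L5

theorem hev_congr {S R : Type*} [CommRing S] [CommRing R] (φ : S →+* R) (d : R) (l : List S)
    (u v u' v' : R) (hu : d ∣ u - u') (hv : d ∣ v - v') (n : ℕ) :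
    d ∣ hev φ n l u v - hev φ n l u' v' := by
  have key : ∀ a b : R, d ∣ a - b ↔
      Ideal.Quotient.mk (Ideal.span {d}) a = Ideal.Quotient.mk (Ideal.span {d}) b := by
    intro a b
    rw [Ideal.Quotient.mk_eq_mk_iff_sub_mem, Ideal.mem_span_singleton]
  rw [key] at hu hv ⊢
  rw [hev_map, hev_map, hu, hv]

theorem prime_dvd_gen {p : ℕ} [Fact p.Prime] (φ : L5 →+* ZMod p) (g : L5) (hg : g ≠ 0)
    (h0 : φ g = 0) (hφ : ∀ x, φ x = 0 → g ∣ x) {q : L5} (hq : Prime q) (h : q ∣ g) : φ q = 0 := by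
  obtain ⟨k, hk⟩ := h
  have h1 : φ q * φ k = 0 := by rw [← map_mul, ← hk, h0]
  rcases mul_eq_zero.1 h1 with h2 | h2
  · exact h2
  · exfalso
    obtain ⟨m, rfl⟩ := hφ k h2
    refine hq.not_isUnit (IsUnit.of_mul_eq_one m (mul_left_cancel₀ hg ?_))
    rw [mul_one]
    conv_rhs => rw [hk]
    ring

theorem not_dvd_int {q : L5} (hq : Prime q) (p y : ℤ) (hp : Prime p) (hy : ¬ p ∣ y)
    (h : q ∣ (y : L5)) : ¬ q ∣ (p : L5) := by
  intro h'
  obtain ⟨a, b, hab⟩ := (hp.coprime_iff_not_dvd).2 hy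
  refine hq.not_dvd_one ?_
  have h1 : (a : L5) * p + b * y = 1 := by exact_mod_cast congrArg (Int.cast : ℤ → L5) hab
  rw [← h1]
  exact dvd_add (dvd_mul_of_dvd_right h' _) (dvd_mul_of_dvd_right h _)

theorem core_factor (u v y : ℤ) (σ z : L5) (huv : IsCoprime u v)
    (hσ : σ ∣ gQ2 ^ 6 * gP2 ^ 3) (hz : σ ^ 2 * z = hev (RingHom.id L5) 6 lF u v)
    (hy : y ^ 2 = -hev (RingHom.id ℤ) 30 lA u v) (y3 : ¬ 3 ∣ y) (y5 : ¬ 5 ∣ y)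
    (hq2 : phiQ2 z ≠ 0) :
    ∃ (j : ℕ) (i : Fin 8) (γ : L5), z = gP2 ^ j * (reps.get i * γ ^ 2) := by
  have hz0 : z ≠ 0 := by rintro rfl; exact hq2 (map_zero _)
  have hπ : ¬ IsUnit gP2 := by
    intro h
    have := h.map phiP2
    rw [show phiP2 gP2 = 0 by decide] at this
    exact not_isUnit_zero this
  obtain ⟨j, w, hw, hzw⟩ := WfDvdMonoid.max_power_factor' hz0 hπ
  have hmul : w * (gP2 ^ j * σ ^ 2 * hev (RingHom.id L5) 24 lF2 u v) = (y : L5) ^ 2 := by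
    have h1 := prod_eq u v
    rw [← hy, ← hz, hzw] at h1
    push_cast at h1
    rw [← h1]; ring
  have hcop : IsCoprime w (gP2 ^ j * σ ^ 2 * hev (RingHom.id L5) 24 lF2 u v) := by
    refine isCoprime_of_prime_dvd ?_ ?_
    · rintro ⟨h, -⟩
      exact hw (h ▸ dvd_zero _)
    · intro q hq hqw hqr
      have nP : ¬ q ∣ gP2 := fun h =>
        hw ((phiP2_dvd q (prime_dvd_gen phiP2 gP2 (by decide) (by decide) phiP2_dvd hq h)).trans hqw)
      have hqz : q ∣ z := hzw ▸ dvd_mul_of_dvd_right hqw _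
      have nQ : ¬ q ∣ gQ2 := by
        intro h
        have h1 := prime_dvd_gen phiQ2 gQ2 (by decide) (by decide) phiQ2_dvd hq h
        obtain ⟨k, rfl⟩ := hqz
        exact hq2 (by rw [map_mul, h1, zero_mul])
      have nσ : ¬ q ∣ σ := by
        intro h
        rcases hq.dvd_or_dvd (h.trans hσ) with h1 | h1
        · exact nQ (hq.dvd_of_dvd_pow h1)
        · exact nP (hq.dvd_of_dvd_pow h1)
      have hβ : q ∣ hev (RingHom.id L5) 24 lF2 u v := by
        rcases hq.dvd_or_dvd hqr with h | h
        · rcases hq.dvd_or_dvd h with h | h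
          · exact absurd (hq.dvd_of_dvd_pow h) nP
          · exact absurd (hq.dvd_of_dvd_pow h) nσ
        · exact h
      have hqy : q ∣ (y : L5) := by
        refine hq.dvd_of_dvd_pow (n := 2) ?_
        rw [← hmul]
        exact dvd_mul_of_dvd_left hqw _
      have q2 : ¬ q ∣ 2 := by
        intro h
        rw [two_eq] at h
        rcases hq.dvd_or_dvd h with h | h
        · rcases hq.dvd_or_dvd h with h | h
          · exact nQ (hq.dvd_of_dvd_pow h)
          · exact nP h
        · refine hq.not_isUnit (isUnit_of_dvd_unit h (IsUnit.of_mul_eq_one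
            ⟨-334736, -112727, -131516, -501932, -528779⟩ (by decide)))
      have q3 : ¬ q ∣ 3 := by
        have := not_dvd_int hq 3 y Int.prime_three y3 hqy
        simpa using this
      have q5 : ¬ q ∣ 5 := by
        have := not_dvd_int hq 5 y (Int.prime_iff_natAbs_prime.2 (by norm_num)) y5 hqy
        simpa using this
      refine common_prime hq u v huv ?_ hβ q2 q3 q5
      rw [← hz]
      exact dvd_mul_of_dvd_right hqz _
  obtain ⟨d, ε, hd⟩ := exists_associated_pow_of_mul_eq_pow' hcop hmul
  obtain ⟨i, η, hη⟩ := unit_decomp ε ε.isUnit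
  refine ⟨j, i, η * d, ?_⟩
  rw [hzw, ← hd, hη]; ring

theorem loc5_sextic : ∀ u v : ZMod 5, (u = 0 ∨ u = -v) → v ≠ 0 →
    hev phi5 6 lF u v = 1 ∨ hev phi5 6 lF u v = -1 := by decide +kernel

theorem loc5_rep : ∀ (i : Fin 8) (a s : ZMod 5), s ^ 2 * (phi5 gP2 * (phi5 (reps.get i) * a ^ 2)) ≠ 1 ∧
    s ^ 2 * (phi5 gP2 * (phi5 (reps.get i) * a ^ 2)) ≠ -1 := by decide +kernel

theorem loc3_sextic : ∀ u v : ZMod 3, u = -v → v ≠ 0 →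
    hev phiP3 6 lF u v = 2 ∧ hev phiQ3 6 lF u v = 1 := by decide +kernel

theorem loc3_rep : ∀ (i : Fin 8) (a s b t : ZMod 3), s ^ 2 * (phiP3 (reps.get i) * a ^ 2) = 2 →
    t ^ 2 * (phiQ3 (reps.get i) * b ^ 2) = 1 → i = 2 ∨ i = 5 := by decide +kernel

theorem phi_hev {p : ℕ} (φ : L5 →+* ZMod p) (n : ℕ) (l : List L5) (u v : ℤ) :
    φ (hev (RingHom.id L5) n l u v) = hev φ n l (u : ZMod p) (v : ZMod p) := by
  rw [hev_map, RingHom.comp_id, map_intCast, map_intCast]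

/-- Obstruction modulo 2 to `z0` being `r` times a square. -/
def Obs2 (z0 r : L5) : Prop := ∀ a b c d e : Fin 2,
  ¬ Dvdc 2 (z0 - r * ⟨(a : ℕ), (b : ℕ), (c : ℕ), (d : ℕ), (e : ℕ)⟩ ^ 2)

instance (z0 r : L5) : Decidable (Obs2 z0 r) := by unfold Obs2; infer_instance

theorem Obs2.ne {z0 r z γ : L5} (h : Obs2 z0 r) (hz : (2 : L5) ∣ z - z0) : z ≠ r * γ ^ 2 := by
  rintro rfl
  have hf : ∀ x : ℤ, ∃ a : Fin 2, ∃ k : ℤ, x = (a : ℕ) + 2 * k := by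
    intro x
    rcases Int.emod_two_eq_zero_or_one x with h | h
    · exact ⟨0, x / 2, by simp; omega⟩
    · exact ⟨1, x / 2, by simp; omega⟩
  obtain ⟨a, a', ha⟩ := hf γ.a
  obtain ⟨b, b', hb⟩ := hf γ.b
  obtain ⟨c, c', hc⟩ := hf γ.c
  obtain ⟨d, d', hd⟩ := hf γ.d
  obtain ⟨e, e', he⟩ := hf γ.e
  have hγ : γ = ⟨(a : ℕ), (b : ℕ), (c : ℕ), (d : ℕ), (e : ℕ)⟩
      + ((2 : ℤ) : L5) * ⟨a', b', c', d', e'⟩ := by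
    rw [intCast_mul_eq]
    ext <;> simp [ha, hb, hc, hd, he]
  refine h a b c d e ((dvd_iff_dvdc 2 _).1 ?_)
  obtain ⟨k, hk⟩ := hz
  generalize (⟨(a : ℕ), (b : ℕ), (c : ℕ), (d : ℕ), (e : ℕ)⟩ : L5) = γ0 at hγ ⊢
  generalize (⟨a', b', c', d', e'⟩ : L5) = δ at hγ
  rw [hγ] at hk
  refine ⟨2 * r * (γ0 * δ + δ ^ 2) - k, ?_⟩
  push_cast at hk ⊢
  linear_combination -hk

theorem phi_sq {R : Type*} [CommRing R] (φ : L5 →+* R) (s r g : L5) :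
    φ (s ^ 2 * (r * g ^ 2)) = φ s ^ 2 * (φ r * φ g ^ 2) := by
  rw [map_mul, map_mul, map_pow, map_pow]

theorem phi_sq' {R : Type*} [CommRing R] (φ : L5 →+* R) (s p r g : L5) :
    φ (s ^ 2 * (p * (r * g ^ 2))) = φ s ^ 2 * (φ p * (φ r * φ g ^ 2)) := by
  rw [map_mul, map_mul, map_mul, map_pow, map_pow]

theorem descent (u v y : ℤ) (σ z z0 : L5) (huv : IsCoprime u v)
    (hσ : σ ∣ gQ2 ^ 6 * gP2 ^ 3) (hz : σ ^ 2 * z = hev (RingHom.id L5) 6 lF u v)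
    (hy : y ^ 2 = -hev (RingHom.id ℤ) 30 lA u v) (y3 : ¬ 3 ∣ y) (y5 : ¬ 5 ∣ y)
    (u3 : (u : ZMod 3) = -v) (u5 : (u : ZMod 5) = 0 ∨ (u : ZMod 5) = -v)
    (v3 : (v : ZMod 3) ≠ 0) (v5 : (v : ZMod 5) ≠ 0)
    (hz0 : (2 : L5) ∣ z - z0) (hq2 : phiQ2 z0 ≠ 0)
    (ho1 : Obs2 z0 (reps.get (2 : Fin 8))) (ho2 : Obs2 z0 (reps.get (5 : Fin 8))) : False := by
  have hq2' : phiQ2 z ≠ 0 := by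
    obtain ⟨k, hk⟩ := hz0
    rw [show z = z0 + 2 * k by rw [← hk]; ring, map_add, map_mul,
      show phiQ2 2 = 0 by decide, zero_mul, add_zero]
    exact hq2
  obtain ⟨j, i, γ, hj⟩ := core_factor u v y σ z huv hσ hz hy y3 y5 hq2'
  obtain ⟨γ', hγ⟩ : ∃ γ', z = reps.get i * γ' ^ 2 := by
    rcases Nat.even_or_odd' j with ⟨k, rfl | rfl⟩
    · exact ⟨gP2 ^ k * γ, by rw [hj]; ring⟩
    · exfalso
      have h5 := loc5_sextic u v u5 v5
      rw [← phi_hev, ← hz, hj, show σ ^ 2 * (gP2 ^ (2 * k + 1) * (reps.get i * γ ^ 2))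
        = σ ^ 2 * (gP2 * (reps.get i * (gP2 ^ k * γ) ^ 2)) by ring, phi_sq'] at h5
      have := loc5_rep i (phi5 (gP2 ^ k * γ)) (phi5 σ)
      exact h5.elim this.1 this.2
  obtain ⟨h3, h3'⟩ := loc3_sextic u v u3 v3
  rw [← phi_hev, ← hz, hγ, phi_sq] at h3 h3'
  rcases loc3_rep i _ _ _ _ h3 h3' with rfl | rfl
  · exact ho1.ne hz0 hγ
  · exact ho2.ne hz0 hγ

open L5

theorem odd_val (p : ℤ) (hp : Prime p) (j : ℕ) : ∀ y m : ℤ, ¬ p ∣ m → y ^ 2 ≠ p ^ (2 * j + 1) * m := by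
  have hp0 := hp.ne_zero
  induction j with
  | zero =>
    intro y m hm h
    rw [Nat.mul_zero, Nat.zero_add, pow_one] at h
    obtain ⟨x, rfl⟩ : p ∣ y := hp.dvd_of_dvd_pow (n := 2) ⟨m, h⟩
    refine hm ⟨x ^ 2, mul_left_cancel₀ hp0 ?_⟩
    rw [← h]; ring
  | succ j ih =>
    intro y m hm h
    obtain ⟨x, rfl⟩ : p ∣ y := hp.dvd_of_dvd_pow (n := 2) ⟨p ^ (2 * j + 2) * m, by rw [h]; ring⟩
    refine ih x m hm (mul_left_cancel₀ (pow_ne_zero 2 hp0) ?_)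
    rw [← mul_pow, h]; ring

/-- The coefficients after the substitution `u = α v + b t`, divided by `c`. -/
def redList (α b c : ℤ) (l : List ℤ) : List ℤ := (lsubst α b l).map (· / c)

theorem odd_val_subst (p : ℕ) [hp : Fact p.Prime] (j : ℕ) (α b : ℤ) (l : List ℤ)
    (hl : l.length ≤ 31)
    (h1 : lsubst α b l = lscale ((p : ℤ) ^ (2 * j + 1)) (redList α b ((p : ℤ) ^ (2 * j + 1)) l))
    (h2 : ∀ t v : ZMod p, v ≠ 0 → hev (Int.castRingHom (ZMod p)) 30
      (redList α b ((p : ℤ) ^ (2 * j + 1)) l) t v ≠ 0)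
    (u v t y : ℤ) (hu : u = α * v + b * t) (hv : (v : ZMod p) ≠ 0)
    (hy : y ^ 2 = -hev (RingHom.id ℤ) 30 l u v) : False := by
  have h3 := (hev_lsubst (RingHom.id ℤ) α b t v l 30 hl).1
  rw [RingHom.id_apply, RingHom.id_apply, ← hu, h1, hev_lscale, RingHom.id_apply] at h3
  refine odd_val p (Nat.prime_iff_prime_int.1 hp.out) j y
    (-hev (RingHom.id ℤ) 30 (redList α b ((p : ℤ) ^ (2 * j + 1)) l) t v) ?_ ?_
  · intro h
    have h4 := (ZMod.intCast_zmod_eq_zero_iff_dvd _ p).2 h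
    rw [Int.cast_neg, neg_eq_zero, ← hev_cast] at h4
    exact h2 _ _ hv h4
  · rw [hy, h3]; ring

theorem cast_sq {p : ℕ} {u v y : ℤ} (hy : y ^ 2 = -hev (RingHom.id ℤ) 30 lA u v) :
    (y : ZMod p) ^ 2 = -hev (Int.castRingHom (ZMod p)) 30 lA (u : ZMod p) (v : ZMod p) := by
  rw [hev_cast, ← Int.cast_neg, ← hy, Int.cast_pow]

theorem loc3_all : ∀ u v y : ZMod 3, y ^ 2 = -hev (Int.castRingHom (ZMod 3)) 30 lA u v →
    (u = 0 ∧ v = 0) ∨ (u = -v ∧ v ≠ 0 ∧ y ≠ 0) ∨ (u = v ∧ v ≠ 0) ∨ (v = 0 ∧ u ≠ 0) := by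
  decide +kernel

theorem loc5_all : ∀ u v y : ZMod 5, y ^ 2 = -hev (Int.castRingHom (ZMod 5)) 30 lA u v →
    (u = 0 ∧ v = 0) ∨ ((u = 0 ∨ u = -v) ∧ v ≠ 0 ∧ y ≠ 0) ∨ (u = v ∧ v ≠ 0) ∨
      (u = 3 * v ∧ v ≠ 0) := by
  decide +kernel

theorem loc8_all : ∀ u v y : ZMod 8, y ^ 2 = -hev (Int.castRingHom (ZMod 8)) 30 lA u v →
    (4 * u = 0 ∧ 4 * v = 0) ∨ (4 * u = 4 ∧ 4 * v = 0) ∨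
      (4 * v = 4 ∧ (u = v ∨ u = -v ∨ u = 3 * v ∨ u = -3 * v)) := by
  decide +kernel

theorem split_of_cast {p : ℕ} {u α v : ℤ} (h : (u : ZMod p) = α * v) :
    ∃ t : ℤ, u = α * v + p * t := by
  have h1 : ((u - α * v : ℤ) : ZMod p) = 0 := by push_cast; rw [h, sub_self]
  obtain ⟨t, ht⟩ := (ZMod.intCast_zmod_eq_zero_iff_dvd _ p).1 h1
  exact ⟨t, by rw [← ht]; ring⟩

theorem not_both {p : ℕ} [hp : Fact p.Prime] {u v : ℤ} (huv : IsCoprime u v) :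
    ¬ ((u : ZMod p) = 0 ∧ (v : ZMod p) = 0) := by
  rintro ⟨h1, h2⟩
  obtain ⟨a, b, hab⟩ := huv
  have h : ((a * u + b * v : ℤ) : ZMod p) = ((1 : ℤ) : ZMod p) := by rw [hab]
  push_cast at h
  rw [h1, h2, mul_zero, mul_zero, add_zero] at h
  exact zero_ne_one h

theorem odd_of_cast {v : ℤ} (h : 4 * (v : ZMod 8) = 4) : v % 2 = 1 := by
  have h1 : ((4 * v - 4 : ℤ) : ZMod 8) = 0 := by push_cast; rw [h, sub_self]
  have := (ZMod.intCast_zmod_eq_zero_iff_dvd _ 8).1 h1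
  omega

theorem even_of_cast {v : ℤ} (h : 4 * (v : ZMod 8) = 0) : v % 2 = 0 := by
  have h1 : ((4 * v : ℤ) : ZMod 8) = 0 := by push_cast; rw [h]
  have := (ZMod.intCast_zmod_eq_zero_iff_dvd _ 8).1 h1
  omega

theorem two_dvd_sub {x c : ℤ} (h : x % 2 = c % 2) : (2 : L5) ∣ (x : L5) - (c : L5) := by
  obtain ⟨k, hk⟩ : (2 : ℤ) ∣ x - c := by omega
  exact ⟨k, by exact_mod_cast congrArg (Int.cast : ℤ → L5) hk⟩

theorem hev_congr_two (l : List L5) (u v c d : ℤ) (hu : u % 2 = c % 2) (hv : v % 2 = d % 2) :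
    (2 : L5) ∣ hev (RingHom.id L5) 6 l (u : L5) (v : L5)
      - hev (RingHom.id L5) 6 l (c : L5) (d : L5) :=
  hev_congr _ 2 l _ _ _ _ (two_dvd_sub hu) (two_dvd_sub hv) 6

/-- The content of the sextic factor when `u` and `v` are both odd. -/
def sigB : L5 := gQ2 ^ 6 * gP2 ^ 3

theorem chk_Gp : lsubst 1 8 lF = lscale (sigB ^ 2) lGp := by decide +kernel
theorem chk_Gm : lsubst (-1) 8 lF = lscale (sigB ^ 2) lGm := by decide +kernel

/-- The conditions modulo 2 on the reduction of `z`. -/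
def Bad (z0 : L5) : Prop :=
  phiQ2 z0 ≠ 0 ∧ Obs2 z0 (reps.get (2 : Fin 8)) ∧ Obs2 z0 (reps.get (5 : Fin 8))

instance (z0 : L5) : Decidable (Bad z0) := by unfold Bad; infer_instance

theorem bad_A : Bad (hev (RingHom.id L5) 6 lF ((1 : ℤ) : L5) ((0 : ℤ) : L5)) := by decide +kernel
theorem bad_p0 : Bad (hev (RingHom.id L5) 6 lGp ((0 : ℤ) : L5) ((1 : ℤ) : L5)) := by decide +kernel
theorem bad_p1 : Bad (hev (RingHom.id L5) 6 lGp ((1 : ℤ) : L5) ((1 : ℤ) : L5)) := by decide +kernel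
theorem bad_m0 : Bad (hev (RingHom.id L5) 6 lGm ((0 : ℤ) : L5) ((1 : ℤ) : L5)) := by decide +kernel
theorem bad_m1 : Bad (hev (RingHom.id L5) 6 lGm ((1 : ℤ) : L5) ((1 : ℤ) : L5)) := by decide +kernel

theorem no_coprime_point (u v y : ℤ) (huv : IsCoprime u v)
    (hy : y ^ 2 = -hev (RingHom.id ℤ) 30 lA u v) : False := by
  have hlen : lA.length ≤ 31 := by decide
  -- the prime 3
  obtain ⟨u3, v3, y3⟩ : (u : ZMod 3) = -v ∧ (v : ZMod 3) ≠ 0 ∧ (y : ZMod 3) ≠ 0 := by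
    rcases loc3_all u v y (cast_sq hy) with h | h | ⟨h, hv⟩ | ⟨h, hu⟩
    · exact absurd h (not_both huv)
    · exact h
    · exfalso
      obtain ⟨t, ht⟩ := split_of_cast (p := 3) (α := 1) (v := v) (by rw [h]; simp)
      exact odd_val_subst 3 0 1 3 lA hlen (by decide +kernel) (by decide +kernel) u v t y ht hv hy
    · exfalso
      obtain ⟨t, ht⟩ := split_of_cast (p := 3) (α := 0) (v := u) (by rw [h]; simp)
      rw [hev_reverse _ _ _ lA 30 (by decide)] at hy
      exact odd_val_subst 3 4 0 3 lA.reverse (by decide) (by decide +kernel) (by decide +kernel)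
        v u t y ht hu hy
  -- the prime 5
  obtain ⟨u5, v5, y5⟩ : ((u : ZMod 5) = 0 ∨ (u : ZMod 5) = -v) ∧ (v : ZMod 5) ≠ 0 ∧
      (y : ZMod 5) ≠ 0 := by
    rcases loc5_all u v y (cast_sq hy) with h | h | ⟨h, hv⟩ | ⟨h, hv⟩
    · exact absurd h (not_both huv)
    · exact h
    · exfalso
      obtain ⟨t, ht⟩ := split_of_cast (p := 5) (α := 1) (v := v) (by rw [h]; simp)
      exact odd_val_subst 5 0 1 5 lA hlen (by decide +kernel) (by decide +kernel) u v t y ht hv hy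
    · exfalso
      obtain ⟨t, ht⟩ := split_of_cast (p := 5) (α := 3) (v := v) (by rw [h]; simp)
      exact odd_val_subst 5 2 3 5 lA hlen (by decide +kernel) (by decide +kernel) u v t y ht hv hy
  have y3' : ¬ (3 : ℤ) ∣ y := fun h => y3 ((ZMod.intCast_zmod_eq_zero_iff_dvd y 3).2 h)
  have y5' : ¬ (5 : ℤ) ∣ y := fun h => y5 ((ZMod.intCast_zmod_eq_zero_iff_dvd y 5).2 h)
  have fin : ∀ σ z z0 : L5, σ ∣ gQ2 ^ 6 * gP2 ^ 3 → σ ^ 2 * z = hev (RingHom.id L5) 6 lF u v →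
      (2 : L5) ∣ z - z0 → Bad z0 → False := fun σ z z0 h1 h2 h3 h4 =>
    descent u v y σ z z0 huv h1 h2 hy y3' y5' u3 u5 v3 v5 h3 h4.1 h4.2.1 h4.2.2
  have odd2 : v % 2 = 1 → (v : ZMod 2) ≠ 0 := fun h h' => by
    have := (ZMod.intCast_zmod_eq_zero_iff_dvd v 2).1 h'
    omega
  -- the prime 2
  rcases loc8_all u v y (cast_sq hy) with ⟨h1, h2⟩ | ⟨h1, h2⟩ | ⟨h1, h2 | h2 | h2 | h2⟩
  · have h3 := even_of_cast h1
    have h4 := even_of_cast h2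
    obtain ⟨a, b, hab⟩ := huv
    obtain ⟨u', rfl⟩ : (2 : ℤ) ∣ u := by omega
    obtain ⟨v', rfl⟩ : (2 : ℤ) ∣ v := by omega
    have : 2 * (a * u' + b * v') = 1 := by rw [← hab]; ring
    omega
  · have h3 := odd_of_cast h1
    have h4 := even_of_cast h2
    exact fin 1 _ _ (one_dvd _) (by rw [one_pow, one_mul])
      (hev_congr_two lF u v 1 0 (by omega) (by omega)) bad_A
  · have h3 := odd_of_cast h1
    obtain ⟨t, ht⟩ := split_of_cast (p := 8) (α := 1) (v := v) (by rw [h2]; simp)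
    have hs := (hev_lsubst (RingHom.id L5) 1 8 t v lF 6 (by decide)).1
    rw [chk_Gp, hev_lscale, RingHom.id_apply, RingHom.id_apply, RingHom.id_apply] at hs
    have hz : sigB ^ 2 * hev (RingHom.id L5) 6 lGp t v = hev (RingHom.id L5) 6 lF u v := by
      rw [← hs, ht]; push_cast; rfl
    rcases Int.emod_two_eq_zero_or_one t with h | h
    · exact fin sigB _ _ dvd_rfl hz (hev_congr_two lGp t v 0 1 (by omega) (by omega)) bad_p0
    · exact fin sigB _ _ dvd_rfl hz (hev_congr_two lGp t v 1 1 (by omega) (by omega)) bad_p1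
  · have h3 := odd_of_cast h1
    obtain ⟨t, ht⟩ := split_of_cast (p := 8) (α := -1) (v := v) (by rw [h2]; simp)
    have hs := (hev_lsubst (RingHom.id L5) (-1) 8 t v lF 6 (by decide)).1
    rw [chk_Gm, hev_lscale, RingHom.id_apply, RingHom.id_apply, RingHom.id_apply] at hs
    have hz : sigB ^ 2 * hev (RingHom.id L5) 6 lGm t v = hev (RingHom.id L5) 6 lF u v := by
      rw [← hs, ht]; push_cast; rfl
    rcases Int.emod_two_eq_zero_or_one t with h | h
    · exact fin sigB _ _ dvd_rfl hz (hev_congr_two lGm t v 0 1 (by omega) (by omega)) bad_m0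
    · exact fin sigB _ _ dvd_rfl hz (hev_congr_two lGm t v 1 1 (by omega) (by omega)) bad_m1
  · have h3 := odd_of_cast h1
    obtain ⟨t, ht⟩ := split_of_cast (p := 8) (α := 3) (v := v) (by rw [h2]; simp)
    exact odd_val_subst 2 8 3 8 lA hlen (by decide +kernel) (by decide +kernel) u v t y ht
      (odd2 h3) hy
  · have h3 := odd_of_cast h1
    obtain ⟨t, ht⟩ := split_of_cast (p := 8) (α := -3) (v := v) (by rw [h2]; simp)
    exact odd_val_subst 2 8 (-3) 8 lA hlen (by decide +kernel) (by decide +kernel) u v t y ht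
      (odd2 h3) hy

theorem no_point (u v y : ℤ) (huv : (u, v) ≠ (0, 0))
    (hy : y ^ 2 = -hev (RingHom.id ℤ) 30 lA u v) : False := by
  have hg : 0 < Int.gcd u v := by
    rw [Nat.pos_iff_ne_zero, Ne, Int.gcd_eq_zero_iff]
    rintro ⟨rfl, rfl⟩
    exact huv rfl
  obtain ⟨u', v', h1, hu, hv⟩ := Int.exists_gcd_one hg
  have hd : ((Int.gcd u v : ℕ) : ℤ) ≠ 0 := by exact_mod_cast hg.ne'
  generalize ((Int.gcd u v : ℕ) : ℤ) = d at hu hv hd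
  rw [hu, hv, mul_comm u', mul_comm v', hev_smul _ _ _ _ _ 30 (by decide)] at hy
  obtain ⟨x, rfl⟩ : d ^ 15 ∣ y := by
    rw [← Int.pow_dvd_pow_iff (n := 2) (by norm_num), hy]
    exact ⟨-hev (RingHom.id ℤ) 30 lA u' v', by ring⟩
  refine no_coprime_point u' v' x (Int.isCoprime_iff_gcd_eq_one.2 h1)
    (mul_left_cancel₀ (pow_ne_zero 30 hd) ?_)
  linear_combination hy

open MvPolynomial

/-- The form `f` is homogeneous of degree 30 with integer coefficients, and the
genus-14 hyperelliptic curve `C_40 : y² = -f(u,v)` has no rational points. -/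
theorem rational_points_C40 :
    fC40.IsHomogeneous 30 ∧
    (∀ m : Fin 2 →₀ ℕ, ∃ z : ℤ, coeff m fC40 = (z : ℚ)) ∧
    ¬ ∃ u v y : ℤ, (u, v) ≠ (0, 0) ∧
        (y : ℚ) ^ 2 = -eval ![(u : ℚ), (v : ℚ)] fC40 := by
  rw [fC40_eq]
  refine ⟨hev_homog lA 30 (by decide), fun m => hev_int_coeff lA 30 m, ?_⟩
  rintro ⟨u, v, y, huv, hy⟩
  rw [eval_hev] at hy
  exact no_point u v y huv (by exact_mod_cast hy)
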